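/- arXiv:math/0508361 — 2 statements merged into one kernel-verified Lean document; each statement's English description precedes it below -/
import Mathlib

section
/- For every real x ≥ 1 and every completely multiplicative function f with -1 ≤ f(n) ≤ 1 for all positive integers n, one has ∑_{n ≤ x} f(n)/n ≥ -1. -/
/-- A completely multiplicative function `f : ℕ → ℝ` (on positive integers):
`f 1 = 1` and `f (m * n) = f m * f n` for all positive `m, n`. -/
def IsComplMult (f : ℕ → ℝ) : Prop :=
  f 1 = 1 ∧ ∀ m n : ℕ, 0 < m → 0 < n → f (m * n) = f m * f n

/-- A geometric sum with ratio in `[-1, 1]` is nonnegative. -/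
theorem geom_sum_nonneg_of_abs_le_one {a : ℝ} (h : |a| ≤ 1) (n : ℕ) :
    0 ≤ ∑ i ∈ Finset.range n, a ^ i := by
  rcases (abs_le.1 h).2.eq_or_lt with rfl | h1
  · simp
  · have hmul := mul_neg_geom_sum a n
    have hpow : a ^ n ≤ 1 := (le_abs_self _).trans (by
      rw [abs_pow]; exact pow_le_one₀ (abs_nonneg a) h)
    exact nonneg_of_mul_nonneg_right (hmul ▸ sub_nonneg.2 hpow) (sub_pos.2 h1)

theorem toArithmeticFunction_apply_of_ne_zero {R : Type*} [Zero R] (f : ℕ → R) {n : ℕ}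
    (hn : n ≠ 0) : toArithmeticFunction f n = f n :=
  if_neg hn

namespace IsComplMult

theorem map_pow {f : ℕ → ℝ} (hf : IsComplMult f) {p : ℕ} (hp : 0 < p) (k : ℕ) :
    f (p ^ k) = f p ^ k := by
  induction k with
  | zero => simpa using hf.1
  | succ k ih => rw [pow_succ, hf.2 _ _ (pow_pos hp k) hp, ih, pow_succ]

theorem isMultiplicative {f : ℕ → ℝ} (hf : IsComplMult f) :
    (toArithmeticFunction f).IsMultiplicative := by
  rw [ArithmeticFunction.IsMultiplicative.iff_ne_zero]
  refine ⟨(toArithmeticFunction_apply_of_ne_zero f one_ne_zero).trans hf.1, fun {m n} hm hn _ => ?_⟩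
  rw [toArithmeticFunction_apply_of_ne_zero f hm, toArithmeticFunction_apply_of_ne_zero f hn,
    toArithmeticFunction_apply_of_ne_zero f (mul_ne_zero hm hn),
    hf.2 m n (Nat.pos_of_ne_zero hm) (Nat.pos_of_ne_zero hn)]

/-- The divisor sums of a completely multiplicative function with values in `[-1, 1]` are
nonnegative. -/
theorem mul_zeta_nonneg {f : ℕ → ℝ} (hf : IsComplMult f) (hb : ∀ n : ℕ, 0 < n → |f n| ≤ 1)
    (n : ℕ) : 0 ≤ (toArithmeticFunction f * (ArithmeticFunction.zeta : ArithmeticFunction ℝ)) n := by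
  rcases eq_or_ne n 0 with rfl | hn
  · simp
  have hmult : (toArithmeticFunction f *
      (ArithmeticFunction.zeta : ArithmeticFunction ℝ)).IsMultiplicative :=
    hf.isMultiplicative.mul ArithmeticFunction.isMultiplicative_zeta.natCast
  rw [hmult.multiplicative_factorization _ hn]
  refine Finset.prod_nonneg fun p hp => ?_
  have hpp : p.Prime := Nat.prime_of_mem_primeFactors hp
  beta_reduce
  rw [ArithmeticFunction.coe_mul_zeta_apply, Nat.sum_divisors_prime_pow hpp]
  refine (geom_sum_nonneg_of_abs_le_one (hb p hpp.pos) (n.factorization p + 1)).trans_eq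
    (Finset.sum_congr rfl fun i _ => ?_)
  rw [toArithmeticFunction_apply_of_ne_zero f (pow_pos hpp.pos i).ne', hf.map_pow hpp.pos]

theorem sum_mul_div_nonneg {f : ℕ → ℝ} (hf : IsComplMult f)
    (hb : ∀ n : ℕ, 0 < n → |f n| ≤ 1) (N : ℕ) :
    0 ≤ ∑ n ∈ Finset.Icc 1 N, f n * (N / n : ℕ) := by
  have h := ArithmeticFunction.sum_Ioc_mul_zeta_eq_sum (toArithmeticFunction f) N
  refine (Finset.sum_nonneg fun n _ => hf.mul_zeta_nonneg hb n).trans_eq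
    (h.trans (Finset.sum_congr rfl fun n hn => ?_))
  rw [toArithmeticFunction_apply_of_ne_zero f (Finset.mem_Ioc.1 hn).1.ne']

end IsComplMult

/-- for all `x ≥ 1` and completely multiplicative `f` with `-1 ≤ f n ≤ 1`,
`∑_{n ≤ x} f n / n ≥ -1`. -/
theorem truncation_ge_neg_one :
    ∀ x : ℝ, 1 ≤ x →
      ∀ f : ℕ → ℝ, IsComplMult f → (∀ n : ℕ, 0 < n → -1 ≤ f n ∧ f n ≤ 1) →
        -1 ≤ ∑ n ∈ Finset.Icc 1 ⌊x⌋₊, f n / n := by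
  intro x hx f hf hb
  have hN : 0 < ⌊x⌋₊ := Nat.floor_pos.2 hx
  generalize ⌊x⌋₊ = N at hN ⊢
  have hNR : (0 : ℝ) < N := Nat.cast_pos.2 hN
  have hnonneg := hf.sum_mul_div_nonneg (fun n hn => abs_le.2 (hb n hn)) N
  have hterm : ∀ n ∈ Finset.Icc 1 N, f n * (N / n : ℕ) - 1 ≤ N * (f n / n) := by
    intro n hn
    have hn0 : 0 < n := (Finset.mem_Icc.1 hn).1
    have hlow : ((N / n : ℕ) : ℝ) ≤ N / n := Nat.cast_div_le
    have hupp : (N : ℝ) / n < (N / n : ℕ) + 1 := by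
      rw [← Nat.floor_div_eq_div (K := ℝ)]
      exact Nat.lt_floor_add_one _
    rw [mul_div_left_comm]
    nlinarith [(hb n hn0).1]
  have hsum := Finset.sum_le_sum hterm
  rw [Finset.sum_sub_distrib, ← Finset.mul_sum, Finset.sum_const, Nat.card_Icc,
    Nat.add_sub_cancel, nsmul_one] at hsum
  nlinarith
end

section
/- There exist a constant C and a real number x₀ such that for every real x ≥ x₀ and every completely multiplicative function f with -1 ≤ f(n) ≤ 1 for all positive integers n, setting g(n) = ∑_{d | n} f(d), one has | ∑_{n ≤ x} f(n)/n − (1/x) ∑_{n ≤ x} g(n) − (1 − γ)·(1/x) ∑_{n ≤ x} f(n) | ≤ C/(log x)^{1/5}, where γ is the Euler–Mascheroni constant. -/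
section

open MeasureTheory FourierTransform

/-- Plancherel's theorem for functions in `L¹ ∩ L²`. -/
theorem fourier_memLp_two_and_integral_norm_sq {f : ℝ → ℂ} (h1 : Integrable f)
    (h2 : MemLp f 2) :
    MemLp (𝓕 f) 2 ∧ ∫ ξ, ‖𝓕 f ξ‖ ^ 2 = ∫ x, ‖f x‖ ^ 2 := by
  set F : Lp ℂ 2 (volume : Measure ℝ) := h2.toLp f with hF
  have hcont : Continuous (𝓕 f) :=
    VectorFourier.fourierIntegral_continuous Real.continuous_fourierChar
      (by exact continuous_inner) h1
  have hae : ∀ᵐ ξ, 𝓕 f ξ = (𝓕 F : Lp ℂ 2 (volume : Measure ℝ)) ξ := by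
    refine ae_eq_of_integral_contDiff_smul_eq hcont.locallyIntegrable
      ((Lp.memLp (𝓕 F : Lp ℂ 2 (volume : Measure ℝ))).locallyIntegrable (by norm_num)) ?_
    intro g hg hgc
    have hgc' : HasCompactSupport (fun x => (g x : ℂ)) :=
      hgc.comp_left (g := fun r : ℝ => (r : ℂ)) (by simp)
    have hg' : ContDiff ℝ (⊤ : ℕ∞) (fun x => (g x : ℂ)) :=
      Complex.ofRealCLM.contDiff.comp hg
    set φ := hgc'.toSchwartzMap hg' with hφ
    have hφv : ∀ x, φ x = (g x : ℂ) := fun x => rfl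
    have key := congrArg (fun T : TemperedDistribution ℝ ℂ => T φ) (Lp.fourier_toTemperedDistribution_eq F)
    simp only [TemperedDistribution.fourier_apply, 
      Lp.toTemperedDistribution_apply (μ := (volume : Measure ℝ)),
      hφv, SchwartzMap.fourier_coe] at key
    have e1 : ∫ x, 𝓕 (φ : ℝ → ℂ) x • F x = ∫ x, 𝓕 (φ : ℝ → ℂ) x • f x := by
      refine integral_congr_ae ?_
      filter_upwards [h2.coeFn_toLp] with x hx
      rw [hF, hx]
    have e2 : ∫ x, 𝓕 (φ : ℝ → ℂ) x • f x = ∫ x, φ x • 𝓕 f x := by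
      have := VectorFourier.integral_fourierIntegral_smul_eq_flip (L := innerₗ ℝ)
        Real.continuous_fourierChar continuous_inner (φ.integrable (μ := volume)) h1
      simpa using! this
    have e3 : ∫ x, g x • 𝓕 f x = ∫ x, φ x • 𝓕 f x := by
      simp [hφv]
    rw [e3, ← e2, ← e1, key]
    simp
  have hm : MemLp (𝓕 f) 2 := (Lp.memLp (𝓕 F : Lp ℂ 2 (volume : Measure ℝ))).ae_eq (by
    filter_upwards [hae] with x hx using hx.symm)
  refine ⟨hm, ?_⟩
  have n1 : ‖(𝓕 F : Lp ℂ 2 (volume : Measure ℝ))‖ ^ 2 = ∫ ξ, ‖𝓕 f ξ‖ ^ 2 := by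
    rw [← inner_self_eq_norm_sq (𝕜 := ℂ), L2.inner_def,
      ← integral_re (L2.integrable_inner _ _)]
    refine integral_congr_ae ?_
    filter_upwards [hae] with x hx
    rw [hx]
    exact inner_self_eq_norm_sq _
  have n2 : ‖F‖ ^ 2 = ∫ ξ, ‖f ξ‖ ^ 2 := by
    rw [← inner_self_eq_norm_sq (𝕜 := ℂ), L2.inner_def,
      ← integral_re (L2.integrable_inner _ _)]
    refine integral_congr_ae ?_
    filter_upwards [h2.coeFn_toLp] with x hx
    rw [hF, hx]
    exact inner_self_eq_norm_sq _
  rw [← n1, ← n2, Lp.norm_fourier_eq]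

theorem fourier_comp_sub_right (f : ℝ → ℂ) (l ξ : ℝ) :
    𝓕 (fun v => f (v - l)) ξ = (Real.fourierChar (-(l * ξ)) : ℂ) * 𝓕 f ξ := by
  rw [Real.fourier_real_eq, Real.fourier_real_eq,
    ← integral_add_right_eq_self (μ := volume) _ l, ← integral_const_mul]
  refine integral_congr_ae (Filter.Eventually.of_forall fun v => ?_)
  simp only [add_sub_cancel_right, Circle.smul_def, smul_eq_mul, ← mul_assoc,
    ← Circle.coe_mul, ← AddChar.map_add_eq_mul]
  congr 3
  ring

theorem fourier_sum_translates {w : ℝ → ℂ} (hw : Integrable w) (s : Finset ℕ) (a : ℕ → ℂ)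
    (l : ℕ → ℝ) (ξ : ℝ) :
    𝓕 (fun v => ∑ n ∈ s, a n * w (v - l n)) ξ =
      (∑ n ∈ s, a n * (Real.fourierChar (-(l n * ξ)) : ℂ)) * 𝓕 w ξ := by
  rw [Finset.sum_mul]
  simp only [mul_assoc, ← fourier_comp_sub_right]
  simp only [Real.fourier_real_eq, Finset.smul_sum]
  rw [integral_finsetSum]
  · refine Finset.sum_congr rfl fun n _ => ?_
    rw [← integral_const_mul]
    refine integral_congr_ae (Filter.Eventually.of_forall fun v => ?_)
    simp only [Circle.smul_def, smul_eq_mul]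
    ring
  · intro n _
    have := ((hw.comp_sub_right (l n)).const_mul (a n))
    simpa [mul_comm] using (Real.fourierIntegral_convergent_iff (V := ℝ) ξ).2 this

theorem memLp_sum_translates {w : ℝ → ℂ} (hw : MemLp w 2) (s : Finset ℕ) (a : ℕ → ℂ)
    (l : ℕ → ℝ) : MemLp (fun v => ∑ n ∈ s, a n * w (v - l n)) 2 :=
  memLp_finsetSum s fun n _ =>
    (hw.comp_measurePreserving (measurePreserving_sub_right volume (l n))).const_mul (a n)

theorem integrable_sum_translates {w : ℝ → ℂ} (hw : Integrable w) (s : Finset ℕ) (a : ℕ → ℂ)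
    (l : ℕ → ℝ) : Integrable (fun v => ∑ n ∈ s, a n * w (v - l n)) :=
  integrable_finsetSum s fun n _ => (hw.comp_sub_right (l n)).const_mul (a n)

/-- If the Fourier transform of `w` is dominated by that of `e`, the `L²` norms of
linear combinations of translates compare likewise. -/
theorem integral_norm_sq_sum_translates_le {w e : ℝ → ℂ} (hw1 : Integrable w) (hw2 : MemLp w 2)
    (he1 : Integrable e) (he2 : MemLp e 2) {M : ℝ} (hM : ∀ ξ, ‖𝓕 w ξ‖ ≤ M * ‖𝓕 e ξ‖)
    (s : Finset ℕ) (a : ℕ → ℂ) (l : ℕ → ℝ) :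
    ∫ v, ‖∑ n ∈ s, a n * w (v - l n)‖ ^ 2 ≤
      M ^ 2 * ∫ v, ‖∑ n ∈ s, a n * e (v - l n)‖ ^ 2 := by
  obtain ⟨m1, p1⟩ := fourier_memLp_two_and_integral_norm_sq
    (integrable_sum_translates hw1 s a l) (memLp_sum_translates hw2 s a l)
  obtain ⟨m2, p2⟩ := fourier_memLp_two_and_integral_norm_sq
    (integrable_sum_translates he1 s a l) (memLp_sum_translates he2 s a l)
  rw [← p1, ← p2, ← integral_const_mul]
  refine integral_mono (m1.integrable_norm_pow (by norm_num))
    ((m2.integrable_norm_pow (by norm_num)).const_mul _) fun ξ => ?_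
  simp only [fourier_sum_translates hw1, fourier_sum_translates he1, norm_mul, mul_pow]
  have := pow_le_pow_left₀ (norm_nonneg _) (hM ξ) 2
  rw [mul_pow] at this
  nlinarith [sq_nonneg ‖∑ n ∈ s, a n * (Real.fourierChar (-(l n * ξ)) : ℂ)‖]

end

section

open MeasureTheory FourierTransform Set

/-- The function `v ↦ v ^ (-1/3) * exp (-v)` on the positive half-line. -/
noncomputable def gammaKernel (v : ℝ) : ℝ :=
  (Ioi (0 : ℝ)).indicator (fun v => Real.exp (-v) * v ^ (-(1 / 3) : ℝ)) v

theorem gammaKernel_of_pos {v : ℝ} (hv : 0 < v) :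
    gammaKernel v = Real.exp (-v) * v ^ (-(1 / 3) : ℝ) :=
  indicator_of_mem hv _

theorem gammaKernel_of_nonpos {v : ℝ} (hv : v ≤ 0) : gammaKernel v = 0 :=
  indicator_of_notMem (by simpa using hv) _

theorem gammaKernel_nonneg (v : ℝ) : 0 ≤ gammaKernel v := by
  rcases lt_or_ge 0 v with hv | hv
  · rw [gammaKernel_of_pos hv]; positivity
  · rw [gammaKernel_of_nonpos hv]

theorem measurable_gammaKernel : Measurable gammaKernel :=
  Measurable.indicator (by fun_prop) measurableSet_Ioi

theorem integrable_gammaKernel : Integrable gammaKernel := by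
  have := Real.GammaIntegral_convergent (s := 2 / 3) (by norm_num)
  unfold gammaKernel
  rw [integrable_indicator_iff measurableSet_Ioi]
  simpa only [show (2 / 3 - 1 : ℝ) = -(1 / 3) by norm_num] using this

theorem integrable_id_mul_gammaKernel : Integrable (fun v => v * gammaKernel v) := by
  have := Real.GammaIntegral_convergent (s := 5 / 3) (by norm_num)
  have h : (fun v => v * gammaKernel v) =
      (Ioi (0 : ℝ)).indicator (fun v => Real.exp (-v) * v ^ ((5 / 3 : ℝ) - 1)) := by
    ext v
    rcases lt_or_ge 0 v with hv | hv
    · rw [gammaKernel_of_pos hv, indicator_of_mem (by exact hv),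
        show ((5 / 3 : ℝ) - 1) = 1 + -(1 / 3) by norm_num, Real.rpow_add hv, Real.rpow_one]
      ring
    · rw [gammaKernel_of_nonpos hv, indicator_of_notMem (by simpa using hv), mul_zero]
  rw [h, integrable_indicator_iff measurableSet_Ioi]
  exact this

theorem integrable_gammaKernel_sq : Integrable (fun v => gammaKernel v ^ 2) := by
  have := Real.GammaIntegral_convergent (s := 1 / 3) (by norm_num)
  have h : Integrable ((Ioi (0 : ℝ)).indicator
      (fun v => Real.exp (-v) * v ^ ((1 / 3 : ℝ) - 1))) := by
    rwa [integrable_indicator_iff measurableSet_Ioi]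
  refine h.mono' (measurable_gammaKernel.pow_const 2).aestronglyMeasurable
    (Filter.Eventually.of_forall fun v => ?_)
  rw [Real.norm_of_nonneg (by positivity)]
  rcases lt_or_ge 0 v with hv | hv
  · rw [gammaKernel_of_pos hv, indicator_of_mem (by exact hv), mul_pow, ← Real.rpow_natCast _ 2,
      ← Real.rpow_natCast _ 2, ← Real.rpow_mul hv.le, ← Real.exp_mul]
    norm_num
    gcongr
    linarith
  · rw [gammaKernel_of_nonpos hv]
    rw [indicator_of_notMem (by simpa using hv)]
    norm_num

theorem memLp_two_gammaKernel : MemLp (fun v => (gammaKernel v : ℂ)) 2 := by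
  have : MemLp gammaKernel 2 := by
    rw [memLp_two_iff_integrable_sq measurable_gammaKernel.aestronglyMeasurable]
    exact integrable_gammaKernel_sq
  exact this.ofReal

/-- The autocorrelation of `gammaKernel` decays exponentially. -/
theorem integral_gammaKernel_mul_le (l m : ℝ) :
    ∫ v, gammaKernel (v - l) * gammaKernel (v - m) ≤
      (∫ v, gammaKernel v ^ 2) * Real.exp (-|l - m|) := by
  wlog h : l ≤ m generalizing l m
  · have := this m l (le_of_not_ge h)
    rw [abs_sub_comm]
    simpa only [mul_comm] using this
  rw [← integral_add_right_eq_self (μ := volume) _ m, mul_comm, ← integral_const_mul]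
  refine integral_mono_of_nonneg (Filter.Eventually.of_forall fun v =>
    mul_nonneg (gammaKernel_nonneg _) (gammaKernel_nonneg _))
    (integrable_gammaKernel_sq.const_mul _) (Filter.Eventually.of_forall fun v => ?_)
  simp only [add_sub_cancel_right]
  rcases lt_or_ge 0 v with hv | hv
  · have h1 : gammaKernel (v + m - l) ≤ Real.exp (-|l - m|) * gammaKernel v := by
      rw [gammaKernel_of_pos hv, gammaKernel_of_pos (by linarith), abs_of_nonpos (by linarith),
        ← mul_assoc, ← Real.exp_add]
      have h2 : (v + m - l) ^ (-(1 / 3) : ℝ) ≤ v ^ (-(1 / 3) : ℝ) :=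
        Real.rpow_le_rpow_of_nonpos hv (by linarith) (by norm_num)
      have h3 : -(v + m - l) = - -(l - m) + -v := by ring
      rw [h3]
      gcongr
    have := gammaKernel_nonneg v
    nlinarith [mul_le_mul_of_nonneg_right h1 this]
  · rw [gammaKernel_of_nonpos hv]; simp

/-- `L²` bound for combinations of translates of `gammaKernel`. -/
theorem integral_norm_sq_sum_gammaKernel_le (s : Finset ℕ) (a : ℕ → ℂ) (l : ℕ → ℝ) :
    ∫ v, ‖∑ n ∈ s, a n * (gammaKernel (v - l n) : ℂ)‖ ^ 2 ≤
      (∫ v, gammaKernel v ^ 2) *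
        ∑ n ∈ s, ∑ m ∈ s, ‖a n‖ * ‖a m‖ * Real.exp (-|l n - l m|) := by
  have hint : ∀ n m : ℕ,
      Integrable (fun v => gammaKernel (v - l n) * gammaKernel (v - l m)) := by
    intro n m
    have h2 : ∀ k, MemLp (fun v => gammaKernel (v - l k)) 2 := fun k => by
      refine (memLp_two_iff_integrable_sq (Measurable.aestronglyMeasurable
        (measurable_gammaKernel.comp (measurable_id.sub_const (l k))))).2 ?_
      exact integrable_gammaKernel_sq.comp_sub_right (l k)
    exact (h2 n).integrable_mul (h2 m)
  calc ∫ v, ‖∑ n ∈ s, a n * (gammaKernel (v - l n) : ℂ)‖ ^ 2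
      ≤ ∫ v, ∑ n ∈ s, ∑ m ∈ s,
          ‖a n‖ * ‖a m‖ * (gammaKernel (v - l n) * gammaKernel (v - l m)) := by
        refine integral_mono_of_nonneg (Filter.Eventually.of_forall fun v => by positivity)
          (integrable_finsetSum _ fun n _ => integrable_finsetSum _ fun m _ =>
            (hint n m).const_mul _) (Filter.Eventually.of_forall fun v => ?_)
        have h1 : ‖∑ n ∈ s, a n * (gammaKernel (v - l n) : ℂ)‖ ≤
            ∑ n ∈ s, ‖a n‖ * gammaKernel (v - l n) := by
          refine (norm_sum_le _ _).trans (Finset.sum_le_sum fun n _ => ?_)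
          rw [norm_mul, Complex.norm_real, Real.norm_of_nonneg (gammaKernel_nonneg _)]
        refine (pow_le_pow_left₀ (norm_nonneg _) h1 2).trans (le_of_eq ?_)
        rw [sq, Finset.sum_mul_sum]
        exact Finset.sum_congr rfl fun n _ => Finset.sum_congr rfl fun m _ => by ring
    _ = ∑ n ∈ s, ∑ m ∈ s,
          ‖a n‖ * ‖a m‖ * ∫ v, gammaKernel (v - l n) * gammaKernel (v - l m) := by
        rw [integral_finsetSum _ fun n _ => integrable_finsetSum _ fun m _ =>
            (hint n m).const_mul _]
        refine Finset.sum_congr rfl fun n _ => ?_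
        rw [integral_finsetSum _ fun m _ => (hint n m).const_mul _]
        exact Finset.sum_congr rfl fun m _ => integral_const_mul _ _
    _ ≤ _ := by
        simp only [Finset.mul_sum]
        refine Finset.sum_le_sum fun n _ => Finset.sum_le_sum fun m _ => ?_
        have := mul_le_mul_of_nonneg_left (integral_gammaKernel_mul_le (l n) (l m))
          (mul_nonneg (norm_nonneg (a n)) (norm_nonneg (a m)))
        linarith

theorem fourier_id_mul_gammaKernel (ξ : ℝ) :
    (1 + 2 * Real.pi * ξ * Complex.I) * 𝓕 (fun v : ℝ => ((v * gammaKernel v : ℝ) : ℂ)) ξ =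
      (2 / 3) * 𝓕 (fun v : ℝ => (gammaKernel v : ℂ)) ξ := by
  set r : ℂ := 1 + 2 * Real.pi * ξ * Complex.I with hr
  set E : ℝ → ℂ := fun v => Complex.exp (-r * v) with hE
  have hchar : ∀ v : ℝ, (Real.fourierChar (-(v * ξ)) : ℂ) * (Real.exp (-v) : ℂ) = E v := by
    intro v
    rw [Real.fourierChar_apply, Complex.ofReal_exp, ← Complex.exp_add, hE, hr]
    congr 1
    push_cast
    ring
  have hF1 : 𝓕 (fun v : ℝ => (gammaKernel v : ℂ)) ξ =
      ∫ v in Ioi (0 : ℝ), ((v ^ (-(1 / 3) : ℝ) : ℝ) : ℂ) * E v := by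
    rw [Real.fourier_real_eq, ← integral_indicator measurableSet_Ioi]
    refine integral_congr_ae (Filter.Eventually.of_forall fun v => ?_)
    simp only [Circle.smul_def, smul_eq_mul]
    rcases lt_or_ge 0 v with hv | hv
    · rw [indicator_of_mem (by exact hv), gammaKernel_of_pos hv, ← hchar]
      push_cast; ring
    · rw [indicator_of_notMem (by simpa using hv), gammaKernel_of_nonpos hv]; simp
  have hF2 : 𝓕 (fun v : ℝ => ((v * gammaKernel v : ℝ) : ℂ)) ξ =
      ∫ v in Ioi (0 : ℝ), ((v ^ (2 / 3 : ℝ) : ℝ) : ℂ) * E v := by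
    rw [Real.fourier_real_eq, ← integral_indicator measurableSet_Ioi]
    refine integral_congr_ae (Filter.Eventually.of_forall fun v => ?_)
    simp only [Circle.smul_def, smul_eq_mul]
    rcases lt_or_ge 0 v with hv | hv
    · rw [indicator_of_mem (by exact hv), gammaKernel_of_pos hv, ← hchar,
        show (2 / 3 : ℝ) = 1 + -(1 / 3) by norm_num, Real.rpow_add hv, Real.rpow_one]
      push_cast; ring
    · rw [indicator_of_notMem (by simpa using hv), gammaKernel_of_nonpos hv]; simp
  have hnE : ∀ v : ℝ, ‖E v‖ = Real.exp (-v) := by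
    intro v
    rw [hE, Complex.norm_exp, hr]
    simp
  have hEc : Continuous E := by fun_prop
  have i1 : IntegrableOn (fun v : ℝ => ((v ^ (-(1 / 3) : ℝ) : ℝ) : ℂ) * E v) (Ioi 0) := by
    have := Real.GammaIntegral_convergent (s := 2 / 3) (by norm_num)
    refine Integrable.mono' this (by
      refine Measurable.aestronglyMeasurable ?_
      exact (Complex.measurable_ofReal.comp (measurable_id.pow_const _)).mul hEc.measurable) ?_
    filter_upwards [ae_restrict_mem measurableSet_Ioi] with v hv
    rw [norm_mul, hnE, Complex.norm_real, Real.norm_of_nonneg (Real.rpow_nonneg (le_of_lt hv) _),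
      mul_comm]
    norm_num
  have i2 : IntegrableOn (fun v : ℝ => ((v ^ (2 / 3 : ℝ) : ℝ) : ℂ) * E v) (Ioi 0) := by
    have := Real.GammaIntegral_convergent (s := 5 / 3) (by norm_num)
    refine Integrable.mono' this (by
      refine Measurable.aestronglyMeasurable ?_
      exact (Complex.measurable_ofReal.comp (measurable_id.pow_const _)).mul hEc.measurable) ?_
    filter_upwards [ae_restrict_mem measurableSet_Ioi] with v hv
    rw [norm_mul, hnE, Complex.norm_real, Real.norm_of_nonneg (Real.rpow_nonneg (le_of_lt hv) _),
      mul_comm]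
    norm_num
  have hd : ∀ v ∈ Ioi (0 : ℝ), HasDerivAt (fun v : ℝ => ((v ^ (2 / 3 : ℝ) : ℝ) : ℂ) * E v)
      ((2 / 3) * (((v ^ (-(1 / 3) : ℝ) : ℝ) : ℂ) * E v) -
        r * (((v ^ (2 / 3 : ℝ) : ℝ) : ℂ) * E v)) v := by
    intro v hv
    have d1 := (Real.hasDerivAt_rpow_const (x := v) (p := 2 / 3) (Or.inl (ne_of_gt hv))).ofReal_comp
    have d2 : HasDerivAt E (E v * (-r * 1)) v :=
      ((Complex.ofRealCLM.hasDerivAt (x := v)).const_mul (-r)).cexp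
    convert! d1.mul d2 using 1
    rw [show (2 / 3 - 1 : ℝ) = -(1 / 3) by norm_num]
    push_cast
    ring
  have hc : ContinuousWithinAt (fun v : ℝ => ((v ^ (2 / 3 : ℝ) : ℝ) : ℂ) * E v) (Ici 0) 0 := by
    refine ContinuousAt.continuousWithinAt ?_
    exact (Complex.continuous_ofReal.continuousAt.comp
      (Real.continuousAt_rpow_const 0 (2 / 3) (Or.inr (by norm_num)))).mul hEc.continuousAt
  have ht : Filter.Tendsto (fun v : ℝ => ((v ^ (2 / 3 : ℝ) : ℝ) : ℂ) * E v) Filter.atTop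
      (nhds 0) := by
    rw [tendsto_zero_iff_norm_tendsto_zero]
    refine (tendsto_rpow_mul_exp_neg_mul_atTop_nhds_zero (2 / 3) 1 one_pos).congr' ?_
    filter_upwards [Filter.eventually_gt_atTop 0] with v hv
    rw [norm_mul, hnE, Complex.norm_real, Real.norm_of_nonneg (Real.rpow_nonneg hv.le _)]
    norm_num
  have hI := integral_Ioi_of_hasDerivAt_of_tendsto hc hd
    ((i1.const_mul (2 / 3)).sub (i2.const_mul r)) ht
  rw [integral_sub (i1.const_mul _) (i2.const_mul _), integral_const_mul, integral_const_mul] at hI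
  rw [hF1, hF2]
  have h0 : (((0 : ℝ) ^ (2 / 3 : ℝ) : ℝ) : ℂ) = 0 := by norm_num
  rw [h0] at hI
  linear_combination -hI

theorem one_add_two_pi_mul_I_mem_slitPlane (ξ : ℝ) :
    (1 + 2 * Real.pi * ξ * Complex.I : ℂ) ∈ Complex.slitPlane := by
  left
  simp

/-- The modulus of the Fourier transform of `gammaKernel`. -/
theorem norm_fourier_gammaKernel (ξ : ℝ) :
    ‖𝓕 (fun v : ℝ => (gammaKernel v : ℂ)) ξ‖ =
      Real.Gamma (2 / 3) * ‖(1 + 2 * Real.pi * ξ * Complex.I : ℂ)‖ ^ (-(2 / 3) : ℝ) := by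
  set g := 𝓕 (fun v : ℝ => (gammaKernel v : ℂ)) with hg
  have i0 : Integrable (fun v : ℝ => (gammaKernel v : ℂ)) := integrable_gammaKernel.ofReal
  have i1 : Integrable (fun v : ℝ => v • (gammaKernel v : ℂ)) := by
    have := integrable_id_mul_gammaKernel.ofReal (𝕜 := ℂ)
    simpa using this
  have hgd : ∀ ξ, HasDerivAt g (-(2 * Real.pi * Complex.I) *
      ((2 / 3) * g ξ / (1 + 2 * Real.pi * ξ * Complex.I))) ξ := by
    intro ξ
    have h := Real.hasDerivAt_fourier i0 i1 ξ
    convert! h using 1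
    have hne : (1 + 2 * Real.pi * ξ * Complex.I : ℂ) ≠ 0 :=
      Complex.slitPlane_ne_zero (one_add_two_pi_mul_I_mem_slitPlane ξ)
    have h2 := fourier_id_mul_gammaKernel ξ
    rw [← hg] at h2
    rw [← h2, mul_div_cancel_left₀ _ hne]
    rw [Real.fourier_real_eq, Real.fourier_real_eq, ← integral_const_mul]
    refine integral_congr_ae (Filter.Eventually.of_forall fun v => ?_)
    simp only [Circle.smul_def, smul_eq_mul]
    push_cast
    ring
  set H : ℝ → ℂ := fun ξ => (1 + 2 * Real.pi * ξ * Complex.I : ℂ) ^ (2 / 3 : ℂ) * g ξ with hH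
  have hHd : ∀ ξ, HasDerivAt H 0 ξ := by
    intro ξ
    have hs := one_add_two_pi_mul_I_mem_slitPlane ξ
    have hne := Complex.slitPlane_ne_zero hs
    have d0 : HasDerivAt (fun ξ : ℝ => (1 + 2 * Real.pi * ξ * Complex.I : ℂ))
        (2 * Real.pi * 1 * Complex.I) ξ :=
      (((Complex.ofRealCLM.hasDerivAt (x := ξ)).const_mul (2 * Real.pi : ℂ)).mul_const
        Complex.I).const_add 1
    have d1 := ((hasDerivAt_id _).cpow_const (c := (2 / 3 : ℂ)) hs).comp ξ d0
    convert! d1.mul (hgd ξ) using 1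
    simp only [id_eq, Function.comp_apply]
    rw [Complex.cpow_sub _ _ hne, Complex.cpow_one]
    field_simp
    ring
  have hconst : H ξ = H 0 := is_const_of_deriv_eq_zero (fun x => (hHd x).differentiableAt)
    (fun x => (hHd x).deriv) ξ 0
  have hg0 : g 0 = (Real.Gamma (2 / 3) : ℂ) := by
    rw [hg, Real.fourier_real_eq]
    simp only [mul_zero, neg_zero, AddChar.map_zero_eq_one, one_smul]
    rw [integral_complex_ofReal, Real.Gamma_eq_integral (by norm_num), ← integral_indicator
      measurableSet_Ioi]
    norm_num [gammaKernel]
  have hn := congrArg norm hconst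
  have hne := Complex.slitPlane_ne_zero (one_add_two_pi_mul_I_mem_slitPlane ξ)
  rw [hH] at hn
  simp only [hg0, norm_mul] at hn
  have e23 : (2 / 3 : ℂ) = ((2 / 3 : ℝ) : ℂ) := by push_cast; ring
  rw [e23, Complex.norm_cpow_real, Complex.norm_real,
    Real.norm_of_nonneg (Real.Gamma_pos_of_pos (by norm_num)).le] at hn
  simp only [Complex.ofReal_zero, mul_zero, zero_mul, add_zero, Complex.one_cpow, norm_one,
    one_mul] at hn
  have hpos : 0 < ‖(1 + 2 * Real.pi * ξ * Complex.I : ℂ)‖ := norm_pos_iff.2 hne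
  rw [Real.rpow_neg hpos.le, ← hn]
  field_simp

end

section

open Complex in
theorem neg_log_norm_one_sub_le {w : ℂ} {ε : ℝ} (hw0 : w ≠ 0) (hw1 : ‖w‖ < 1) (hε : |ε| ≤ 1) :
    -Real.log ‖1 - ε * w‖ ≤
      17 / 24 * -Real.log ‖1 - (‖w‖ : ℂ)‖ + 1 / 3 * -Real.log ‖1 - w ^ 2 / ‖w‖‖ := by
  have hr : 0 < ‖w‖ := norm_pos_iff.mpr hw0
  have key (z : ℂ) (hz : ‖z‖ < 1) : HasSum (fun n : ℕ => (z ^ n / n).re) (-Real.log ‖1 - z‖) := by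
    have := Complex.hasSum_re (Complex.hasSum_taylorSeries_neg_log hz)
    rwa [neg_re, Complex.log_re] at this
  have h1 := key (ε * w) (by
    rw [norm_mul, Complex.norm_real, Real.norm_eq_abs]
    nlinarith [abs_nonneg ε])
  have h2 := (key (‖w‖ : ℂ) (by simpa using hw1)).mul_left (17 / 24)
  have h3 := (key (w ^ 2 / ‖w‖) (by
    rw [norm_div, norm_pow, Complex.norm_real, norm_norm, sq, mul_div_cancel_right₀ _ hr.ne']
    exact hw1)).mul_left (1 / 3)
  refine hasSum_le (fun n => ?_) h1 (h2.add h3)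
  have hd (z : ℂ) : (z / (n : ℂ)).re = z.re / n := by
    rw [← ofReal_natCast, div_ofReal_re]
  simp only [hd]
  rw [mul_pow, ← ofReal_pow, re_ofReal_mul, div_pow, ← ofReal_pow, div_ofReal_re,
    ofReal_re, ← pow_mul, mul_comm 2 n, pow_mul, sq (w ^ n), mul_re]
  have hn : (w ^ n).re * (w ^ n).re + (w ^ n).im * (w ^ n).im = (‖w‖ ^ n) ^ 2 := by
    rw [← norm_pow, ← normSq_eq_norm_sq, normSq_apply]
  set a := (w ^ n).re
  set b := (w ^ n).im
  set ρ := ‖w‖ ^ n with hρ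
  have hρ0 : 0 < ρ := by positivity
  have hεn : |ε ^ n| ≤ 1 := by rw [abs_pow]; exact pow_le_one₀ (abs_nonneg _) hε
  have h5 : ε ^ n * a ≤ |a| := by
    calc ε ^ n * a ≤ |ε ^ n * a| := le_abs_self _
      _ = |ε ^ n| * |a| := abs_mul _ _
      _ ≤ 1 * |a| := by gcongr
      _ = |a| := one_mul _
  have h6 : |a| ≤ 17 / 24 * ρ + 1 / 3 * ((a * a - b * b) / ρ) := by
    have : 17 / 24 * ρ + 1 / 3 * ((a * a - b * b) / ρ) - |a| =
        (3 / 8 * ρ ^ 2 + 2 / 3 * a ^ 2 - |a| * ρ) / ρ := by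
      field_simp
      nlinarith
    have h7 : 0 ≤ (3 / 8 * ρ ^ 2 + 2 / 3 * a ^ 2 - |a| * ρ) / ρ := by
      apply div_nonneg _ hρ0.le
      nlinarith [sq_nonneg (3 * ρ - 4 * |a|), sq_abs a]
    linarith
  calc ε ^ n * a / n ≤ (17 / 24 * ρ + 1 / 3 * ((a * a - b * b) / ρ)) / n := by
        gcongr; exact h5.trans h6
    _ = _ := by ring

open Complex in
theorem norm_tsum_eq_exp {F : ℕ →*₀ ℂ} (hF : Summable (‖F ·‖)) :
    (Summable fun p : Nat.Primes => -Real.log ‖1 - F p‖) ∧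
      ‖∑' n, F n‖ = Real.exp (∑' p : Nat.Primes, -Real.log ‖1 - F p‖) := by
  have h1 : Summable fun p : Nat.Primes => -Complex.log (1 - F p) :=
    (hF.of_norm.clog_one_sub.neg.subtype Nat.Prime :)
  have h2 := Complex.hasSum_re h1.hasSum
  simp only [neg_re, Complex.log_re] at h2
  refine ⟨h2.summable, ?_⟩
  rw [← EulerProduct.exp_tsum_primes_log_eq_tsum hF, Complex.norm_exp, h2.tsum_eq]

open Complex in
theorem norm_LSeries_le_zeta {f : ℕ → ℝ} (hf : IsComplMult f)
    (hb : ∀ n : ℕ, 0 < n → -1 ≤ f n ∧ f n ≤ 1) {σ y : ℝ} (hσ : 0 < σ) :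
    ‖LSeries (fun n => (f n : ℂ)) (1 + σ + y * I)‖ ≤
      ‖riemannZeta (1 + σ)‖ ^ (17 / 24 : ℝ) * ‖riemannZeta (1 + σ + 2 * y * I)‖ ^ (1 / 3 : ℝ) := by
  set s : ℂ := 1 + σ + y * I with hs
  have hs1 : 1 < s.re := by simp [hs, hσ]
  have hs2 : 1 < (1 + σ : ℂ).re := by simp [hσ]
  have hs3 : 1 < (1 + σ + 2 * y * I : ℂ).re := by simp [hσ]
  have hs0 : s ≠ 0 := ne_zero_of_one_lt_re hs1
  let F : ℕ →*₀ ℂ :=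
    { toFun n := f n * (n : ℂ) ^ (-s)
      map_zero' := by simp [hs0]
      map_one' := by simp [hf.1]
      map_mul' m n := by
        rcases Nat.eq_zero_or_pos m with rfl | hm
        · simp [hs0]
        rcases Nat.eq_zero_or_pos n with rfl | hn
        · simp [hs0]
        have := (riemannZetaSummandHom hs0).map_mul m n
        simp only [riemannZetaSummandHom, MonoidWithZeroHom.coe_mk, ZeroHom.coe_mk] at this
        rw [this, hf.2 m n hm hn]
        push_cast
        ring }
  have hFa (n : ℕ) : F n = f n * (n : ℂ) ^ (-s) := rfl
  have hFs : Summable (‖F ·‖) := by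
    refine (summable_riemannZetaSummand hs1).of_nonneg_of_le (fun _ => norm_nonneg _) fun n => ?_
    rcases Nat.eq_zero_or_pos n with rfl | hn
    · simp
    rw [hFa, norm_mul, Complex.norm_real, Real.norm_eq_abs]
    exact mul_le_of_le_one_left (norm_nonneg _) (abs_le.mpr (hb n hn))
  have hL : LSeries (fun n => (f n : ℂ)) s = ∑' n, F n := by
    refine tsum_congr fun n => ?_
    rcases Nat.eq_zero_or_pos n with rfl | hn
    · simp
    · rw [LSeries.term_of_ne_zero hn.ne', hFa, cpow_neg, div_eq_mul_inv]
  have e1 := norm_tsum_eq_exp hFs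
  have e2 := norm_tsum_eq_exp (summable_riemannZetaSummand hs2)
  have e3 := norm_tsum_eq_exp (summable_riemannZetaSummand hs3)
  rw [tsum_riemannZetaSummand hs2] at e2
  rw [tsum_riemannZetaSummand hs3] at e3
  rw [hL, e1.2, e2.2, e3.2, ← Real.exp_mul, ← Real.exp_mul, ← Real.exp_add, Real.exp_le_exp,
    mul_comm _ (17 / 24 : ℝ), mul_comm _ (1 / 3 : ℝ), ← tsum_mul_left, ← tsum_mul_left,
    ← (e2.1.mul_left _).tsum_add (e3.1.mul_left _)]
  refine e1.1.tsum_le_tsum (fun p => ?_) ((e2.1.mul_left _).add (e3.1.mul_left _))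
  have hp : 0 < (p : ℕ) := p.prop.pos
  have hp1 : 1 < ((p : ℕ) : ℝ) := by exact_mod_cast p.prop.one_lt
  have hp0 : ((p : ℕ) : ℂ) ≠ 0 := by exact_mod_cast hp.ne'
  have hnorm : ‖((p : ℕ) : ℂ) ^ (-s)‖ = ((p : ℕ) : ℝ) ^ (-(1 + σ)) := by
    rw [Complex.norm_natCast_cpow_of_pos hp]
    simp [hs]
  have hnc : ((‖((p : ℕ) : ℂ) ^ (-s)‖ : ℝ) : ℂ) = ((p : ℕ) : ℂ) ^ (-(1 + σ) : ℂ) := by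
    rw [hnorm, Complex.ofReal_cpow (by positivity)]
    push_cast
    rfl
  have h := neg_log_norm_one_sub_le (w := ((p : ℕ) : ℂ) ^ (-s)) (ε := f p)
    (by simp [Complex.cpow_eq_zero_iff, hp0])
    (by rw [hnorm]; exact Real.rpow_lt_one_of_one_lt_of_neg hp1 (by linarith))
    (abs_le.mpr (hb p hp))
  have hq : (((p : ℕ) : ℂ) ^ (-s)) ^ 2 / (‖((p : ℕ) : ℂ) ^ (-s)‖ : ℂ) =
      ((p : ℕ) : ℂ) ^ (-(1 + σ + 2 * y * I)) := by
    rw [hnc, sq, ← Complex.cpow_add _ _ hp0, ← Complex.cpow_sub _ _ hp0]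
    congr 1
    rw [hs]; ring
  rw [hq, hnc] at h
  exact h

end

section

open MeasureTheory FourierTransform Set

open Complex in
theorem norm_riemannZeta_le {s : ℂ} (hs : 1 < s.re) :
    ‖riemannZeta s‖ ≤ ‖s‖ * (1 + 1 / ‖s - 1‖) := by
  have hs1 : s - 1 ≠ 0 := by
    intro h
    have : (s - 1).re = 0 := by rw [h]; simp
    simp at this
    linarith
  have hpow {t : ℝ} (ht : t ∈ Ioi (1 : ℝ)) : (t : ℂ) * (t : ℂ) ^ (-(s + 1)) = (t : ℂ) ^ (-s) := by
    have ht0 : (t : ℂ) ≠ 0 := by exact_mod_cast (zero_lt_one.trans ht).ne'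
    rw [neg_add, cpow_add _ _ ht0, cpow_neg_one]
    field_simp
  have hint1 : IntegrableOn (fun t : ℝ => (t : ℂ) ^ (-s)) (Ioi 1) :=
    integrableOn_Ioi_cpow_of_lt (by simpa using hs) zero_lt_one
  have hbd : IntegrableOn (fun t : ℝ => t ^ (-2 : ℝ)) (Ioi 1) :=
    integrableOn_Ioi_rpow_of_lt (by norm_num) zero_lt_one
  have hle : ∀ t ∈ Ioi (1 : ℝ), ‖((Int.fract t : ℝ) : ℂ) * (t : ℂ) ^ (-(s + 1))‖ ≤ t ^ (-2 : ℝ) := by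
    intro t ht
    have ht0 : 0 < t := zero_lt_one.trans ht
    rw [norm_mul, norm_cpow_eq_rpow_re_of_pos ht0, norm_real, Real.norm_eq_abs,
      abs_of_nonneg (Int.fract_nonneg t)]
    calc Int.fract t * t ^ (-(s + 1)).re ≤ 1 * t ^ (-(s + 1)).re := by
          gcongr; exact (Int.fract_lt_one t).le
      _ ≤ t ^ (-2 : ℝ) := by
          rw [one_mul]
          exact Real.rpow_le_rpow_of_exponent_le (le_of_lt ht) (by simp; linarith)
  have hint2 : IntegrableOn (fun t : ℝ => ((Int.fract t : ℝ) : ℂ) * (t : ℂ) ^ (-(s + 1))) (Ioi 1) := by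
    refine hbd.mono' ?_ ((ae_restrict_iff' measurableSet_Ioi).mpr (.of_forall hle))
    refine Measurable.aestronglyMeasurable ?_
    have : Measurable (Int.fract : ℝ → ℝ) := measurable_fract
    fun_prop
  have hzeta : riemannZeta s = s * ((1 : ℂ) / (s - 1) -
      ∫ t in Ioi (1 : ℝ), ((Int.fract t : ℝ) : ℂ) * (t : ℂ) ^ (-(s + 1))) := by
    rw [← LSeries_one_eq_riemannZeta hs, LSeries_eq_mul_integral' 1 zero_le_one hs]
    · congr 1
      have : (1 : ℂ) / (s - 1) = ∫ t in Ioi (1 : ℝ), (t : ℂ) ^ (-s) := by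
        rw [integral_Ioi_cpow_of_lt (by simpa using hs) zero_lt_one]
        simp only [ofReal_one, one_cpow]
        rw [neg_add_eq_sub, ← neg_sub s 1, neg_div_neg_eq]
      rw [this, ← integral_sub hint1 hint2]
      refine setIntegral_congr_fun measurableSet_Ioi fun t ht => ?_
      have ht0 : 0 ≤ t := zero_le_one.trans (le_of_lt ht)
      simp only [Pi.one_apply, Finset.sum_const, Nat.card_Icc, nsmul_eq_mul, mul_one,
        Nat.add_sub_cancel]
      rw [← hpow ht, ← sub_mul]
      congr 1
      have : ((⌊t⌋₊ : ℝ) : ℂ) = ((t - Int.fract t : ℝ) : ℂ) := by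
        rw [natCast_floor_eq_intCast_floor ht0, Int.self_sub_fract]
      rw [← ofReal_sub, ← this, ofReal_natCast]
    · simp only [Pi.one_apply, norm_one, Finset.sum_const, Nat.card_Icc, nsmul_eq_mul, mul_one,
        Nat.add_sub_cancel, Real.rpow_one]
      exact Asymptotics.isBigO_refl _ _
  rw [hzeta, norm_mul]
  gcongr
  refine (norm_sub_le _ _).trans ?_
  rw [add_comm, norm_div, norm_one]
  gcongr
  calc _ ≤ ∫ t in Ioi (1 : ℝ), t ^ (-2 : ℝ) :=
        norm_integral_le_of_norm_le hbd ((ae_restrict_iff' measurableSet_Ioi).mpr (.of_forall hle))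
    _ = 1 := by
        rw [integral_Ioi_rpow_of_lt (by norm_num) zero_lt_one]
        norm_num

/-- The partial sum `∑_{1 ≤ n ≤ t} f n`. -/
noncomputable def partialSum (f : ℕ → ℝ) (t : ℝ) : ℝ := ∑ n ∈ Finset.Icc 1 ⌊t⌋₊, f n

/-- The mean value `t⁻¹ ∑_{1 ≤ n ≤ t} f n`. -/
noncomputable def meanValue (f : ℕ → ℝ) (t : ℝ) : ℝ := partialSum f t / t

/-- The variation of the mean value of `f` between `t / z` and `t`. -/
noncomputable def meanDiff (f : ℕ → ℝ) (z t : ℝ) : ℝ := meanValue f t - meanValue f (t / z)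

section bounds

variable {f : ℕ → ℝ}

theorem partialSum_of_lt_one {t : ℝ} (ht : t < 1) : partialSum f t = 0 := by
  simp [partialSum, Nat.floor_eq_zero.mpr ht]

theorem meanValue_of_lt_one {t : ℝ} (ht : t < 1) : meanValue f t = 0 := by
  simp [meanValue, partialSum_of_lt_one ht]

theorem measurable_partialSum : Measurable (partialSum f) :=
  (measurable_of_countable fun n : ℕ => ∑ k ∈ Finset.Icc 1 n, f k).comp Nat.measurable_floor

theorem measurable_meanValue : Measurable (meanValue f) :=
  measurable_partialSum.div measurable_id

theorem measurable_meanDiff {z : ℝ} : Measurable (meanDiff f z) :=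
  measurable_meanValue.sub (measurable_meanValue.comp (measurable_id.div_const z))

variable (hb : ∀ n : ℕ, 0 < n → |f n| ≤ 1)
include hb

theorem abs_partialSum_le {t : ℝ} (ht : 0 ≤ t) : |partialSum f t| ≤ t := by
  calc |partialSum f t| ≤ ∑ n ∈ Finset.Icc 1 ⌊t⌋₊, |f n| := Finset.abs_sum_le_sum_abs _ _
    _ ≤ ∑ n ∈ Finset.Icc 1 ⌊t⌋₊, (1 : ℝ) :=
        Finset.sum_le_sum fun n hn => hb n (Finset.mem_Icc.mp hn).1
    _ = (⌊t⌋₊ : ℝ) := by simp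
    _ ≤ t := Nat.floor_le ht

theorem abs_meanValue_le (t : ℝ) : |meanValue f t| ≤ 1 := by
  rcases le_or_gt 0 t with ht | ht
  · rw [meanValue, abs_div, abs_of_nonneg ht]
    exact div_le_one_of_le₀ (abs_partialSum_le hb ht) ht
  · rw [meanValue_of_lt_one (by linarith)]
    simp

theorem abs_meanDiff_le (z t : ℝ) : |meanDiff f z t| ≤ 2 := by
  have h1 := abs_meanValue_le hb t
  have h2 := abs_meanValue_le hb (t / z)
  calc |meanDiff f z t| ≤ |meanValue f t| + |meanValue f (t / z)| := abs_sub _ _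
    _ ≤ 2 := by linarith

end bounds

theorem meanDiff_of_lt_one {f : ℕ → ℝ} {z t : ℝ} (hz : 1 ≤ z) (ht : t < 1) :
    meanDiff f z t = 0 := by
  have : t / z < 1 := by
    rw [div_lt_one (by linarith)]
    linarith
  simp [meanDiff, meanValue_of_lt_one, ht, this]

/-- The exponentially damped mean value `v ↦ e^{-σ v} meanValue f (e^v)`. -/
noncomputable def dampedMean (f : ℕ → ℝ) (σ v : ℝ) : ℝ := Real.exp (-σ * v) * meanValue f (Real.exp v)

/-- The exponentially damped variation `v ↦ e^{-σ v} meanDiff f z (e^v)`. -/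
noncomputable def dampedDiff (f : ℕ → ℝ) (z σ v : ℝ) : ℝ :=
  Real.exp (-σ * v) * meanDiff f z (Real.exp v)

theorem dampedDiff_eq {f : ℕ → ℝ} {z σ v : ℝ} (hz : 1 ≤ z) :
    dampedDiff f z σ v =
      dampedMean f σ v - Real.exp (-σ * Real.log z) * dampedMean f σ (v - Real.log z) := by
  have hz0 : 0 < z := by linarith
  rw [dampedDiff, meanDiff, dampedMean, dampedMean, ← mul_assoc, ← Real.exp_add, Real.exp_sub,
    Real.exp_log hz0]
  ring_nf

theorem memLp_of_norm_le_exp {g : ℝ → ℂ} {σ C : ℝ} (hσ : 0 < σ) (hg : Measurable g)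
    (h0 : ∀ v < 0, g v = 0) (hle : ∀ v, ‖g v‖ ≤ C * Real.exp (-σ * v)) :
    Integrable g ∧ MemLp g 2 := by
  have key (c : ℝ) (hc : 0 < c) (D : ℝ) :
      Integrable ((Ici (0 : ℝ)).indicator fun v => D * Real.exp (-c * v)) := by
    rw [integrable_indicator_iff measurableSet_Ici, integrableOn_Ici_iff_integrableOn_Ioi]
    exact (exp_neg_integrableOn_Ioi 0 hc).const_mul D
  constructor
  · refine (key σ hσ C).mono' hg.aestronglyMeasurable (.of_forall fun v => ?_)
    by_cases hv : 0 ≤ v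
    · rw [indicator_of_mem (by exact hv)]
      exact hle v
    · simp [h0 v (not_le.mp hv), hv]
  · rw [memLp_two_iff_integrable_sq_norm hg.aestronglyMeasurable]
    refine (key (2 * σ) (by positivity) (C ^ 2)).mono' (by fun_prop) (.of_forall fun v => ?_)
    by_cases hv : 0 ≤ v
    · rw [indicator_of_mem (by exact hv), Real.norm_of_nonneg (by positivity)]
      calc ‖g v‖ ^ 2 ≤ (C * Real.exp (-σ * v)) ^ 2 := by gcongr; exact hle v
        _ = C ^ 2 * Real.exp (-(2 * σ) * v) := by
          rw [mul_pow, ← Real.exp_nat_mul]; push_cast; ring_nf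
    · simp [h0 v (not_le.mp hv), hv]

section damped

variable {f : ℕ → ℝ} {z σ : ℝ} (hb : ∀ n : ℕ, 0 < n → |f n| ≤ 1) (hσ : 0 < σ)
include hb hσ

theorem dampedMean_memLp :
    Integrable (fun v => (dampedMean f σ v : ℂ)) ∧ MemLp (fun v => (dampedMean f σ v : ℂ)) 2 := by
  refine memLp_of_norm_le_exp (C := 1) hσ ?_ (fun v hv => ?_) fun v => ?_
  · unfold dampedMean
    have := (measurable_meanValue (f := f)).comp Real.measurable_exp
    simp only [Function.comp_def] at this
    fun_prop
  · simp [dampedMean, meanValue_of_lt_one (Real.exp_lt_one_iff.mpr hv)]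
  · rw [Complex.norm_real, Real.norm_eq_abs, dampedMean, abs_mul, Real.abs_exp, mul_comm]
    gcongr
    exact abs_meanValue_le hb _

theorem dampedDiff_memLp (hz : 1 ≤ z) :
    Integrable (fun v => (dampedDiff f z σ v : ℂ)) ∧
      MemLp (fun v => (dampedDiff f z σ v : ℂ)) 2 := by
  refine memLp_of_norm_le_exp (C := 2) hσ ?_ (fun v hv => ?_) fun v => ?_
  · unfold dampedDiff
    have := (measurable_meanDiff (f := f) (z := z)).comp Real.measurable_exp
    simp only [Function.comp_def] at this
    fun_prop
  · simp [dampedDiff, meanDiff_of_lt_one hz (Real.exp_lt_one_iff.mpr hv)]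
  · rw [Complex.norm_real, Real.norm_eq_abs, dampedDiff, abs_mul, Real.abs_exp, mul_comm]
    gcongr
    exact abs_meanDiff_le hb _ _

open Complex in
theorem fourier_dampedMean (ξ : ℝ) :
    (1 + σ + (2 * Real.pi * ξ : ℝ) * I) * 𝓕 (fun v => (dampedMean f σ v : ℂ)) ξ =
      LSeries (fun n => (f n : ℂ)) (1 + σ + (2 * Real.pi * ξ : ℝ) * I) := by
  set u : ℂ := σ + (2 * Real.pi * ξ : ℝ) * I with hu
  have hure : u.re = σ := by simp [hu]
  have huim : u.im / (2 * Real.pi) = ξ := by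
    simp only [hu, add_im, ofReal_im, mul_im, ofReal_re, I_im, I_re, mul_one, mul_zero,
      zero_add, add_zero]
    field_simp
  rw [add_assoc, ← hu, LSeries_eq_mul_integral' _ zero_le_one (s := 1 + u)
    (by simp [hure, hσ])]
  · congr 1
    have h := mellin_eq_fourier (fun t : ℝ => (meanValue f t⁻¹ : ℂ)) (s := u)
    rw [mellin_comp_inv (fun t : ℝ => (meanValue f t : ℂ)), huim, hure] at h
    have h2 : (fun v : ℝ => (dampedMean f σ v : ℂ)) =
        fun v => Real.exp (-σ * v) • (meanValue f (Real.exp (-v))⁻¹ : ℂ) := by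
      ext v
      rw [← Real.exp_neg, neg_neg, dampedMean, ofReal_mul, real_smul]
    rw [h2, ← h, mellin]
    have h3 : ∀ t ∈ Ioi (0 : ℝ), (t : ℂ) ^ (-u - 1) • (meanValue f t : ℂ) =
        (Ioi (1 : ℝ)).indicator (fun t : ℝ => (∑ k ∈ Finset.Icc 1 ⌊t⌋₊, (f k : ℂ)) *
          (t : ℂ) ^ (-(1 + u + 1))) t ∨ t = 1 := by
      intro t ht
      rcases lt_trichotomy t 1 with h1 | h1 | h1
      · left
        rw [meanValue_of_lt_one h1, indicator_of_notMem (by simp [h1.le])]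
        simp
      · right; exact h1
      · left
        have ht0 : (t : ℂ) ≠ 0 := by exact_mod_cast (mem_Ioi.mp ht).ne'
        rw [indicator_of_mem (by exact h1), meanValue, partialSum, smul_eq_mul, ofReal_div,
          ofReal_sum, show -(1 + u + 1) = (-u - 1) - 1 by ring, cpow_sub (-u - 1) 1 ht0, cpow_one]
        ring
    rw [setIntegral_congr_ae (g := (Ioi (1 : ℝ)).indicator (fun t : ℝ =>
      (∑ k ∈ Finset.Icc 1 ⌊t⌋₊, (f k : ℂ)) * (t : ℂ) ^ (-(1 + u + 1)))) measurableSet_Ioi]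
    · rw [setIntegral_indicator measurableSet_Ioi, Ioi_inter_Ioi]
      simp
    · have : ∀ᵐ t : ℝ, t ≠ 1 := by simp [ae_iff]
      filter_upwards [this] with t ht1 ht
      exact (h3 t ht).resolve_right ht1
  · refine Asymptotics.IsBigO.of_bound 1 (.of_forall fun n => ?_)
    rw [Real.rpow_one, one_mul, Real.norm_natCast, Real.norm_of_nonneg (by positivity)]
    calc ∑ k ∈ Finset.Icc 1 n, ‖(f k : ℂ)‖ ≤ ∑ k ∈ Finset.Icc 1 n, (1 : ℝ) := by
          refine Finset.sum_le_sum fun k hk => ?_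
          rw [norm_real]
          exact hb k (Finset.mem_Icc.mp hk).1
      _ = n := by simp

end damped

end

section

open MeasureTheory FourierTransform Set

section damped

variable {f : ℕ → ℝ} {z σ : ℝ} (hb : ∀ n : ℕ, 0 < n → |f n| ≤ 1) (hσ : 0 < σ)
include hb hσ

open Complex in
theorem fourier_dampedDiff (hz : 1 ≤ z) (ξ : ℝ) :
    𝓕 (fun v => (dampedDiff f z σ v : ℂ)) ξ =
      (1 - exp (-((σ + (2 * Real.pi * ξ : ℝ) * I) * Real.log z))) *
        𝓕 (fun v => (dampedMean f σ v : ℂ)) ξ := by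
  have hw := (dampedMean_memLp hb hσ).1
  have h1 : (fun v => (dampedDiff f z σ v : ℂ)) = (fun v => (dampedMean f σ v : ℂ)) +
      (-(Real.exp (-σ * Real.log z) : ℂ)) •
        fun v => (dampedMean f σ (v - Real.log z) : ℂ) := by
    ext v
    simp only [dampedDiff_eq hz, Pi.add_apply, Pi.smul_apply, smul_eq_mul]
    push_cast
    ring
  have hw2 : Integrable fun v => (dampedMean f σ (v - Real.log z) : ℂ) := hw.comp_sub_right _
  have h2 := fourier_comp_sub_right (fun v => (dampedMean f σ v : ℂ)) (Real.log z) ξ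
  have h3 := VectorFourier.fourierIntegral_add (L := (innerₗ ℝ)) Real.continuous_fourierChar
    (by fun_prop) hw (hw2.smul (-(Real.exp (-σ * Real.log z) : ℂ)))
  have h4 : 𝓕 (fun v => (dampedDiff f z σ v : ℂ)) ξ = 𝓕 (fun v => (dampedMean f σ v : ℂ)) ξ +
      (-(Real.exp (-σ * Real.log z) : ℂ)) *
        𝓕 (fun v => (dampedMean f σ (v - Real.log z) : ℂ)) ξ := by
    rw [h1]
    have := congrFun h3 ξ
    rw [VectorFourier.fourierIntegral_const_smul] at this
    exact this
  rw [h4, h2, Real.fourierChar_apply]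
  have : (Real.exp (-σ * Real.log z) : ℂ) * exp (2 * Real.pi * (-(Real.log z * ξ) : ℝ) * I) =
      exp (-((σ + (2 * Real.pi * ξ : ℝ) * I) * Real.log z)) := by
    rw [ofReal_exp, ← exp_add]
    push_cast
    ring_nf
  push_cast at this ⊢
  rw [← this]
  ring

end damped

open Complex in
theorem norm_one_sub_exp_neg_le {w : ℂ} (hw : 0 ≤ w.re) : ‖1 - exp (-w)‖ ≤ ‖w‖ ∧
    ‖1 - exp (-w)‖ ≤ 2 := by
  have hexp {v : ℂ} (hv : 0 ≤ v.re) : ‖exp (-v)‖ ≤ 1 := by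
    rw [norm_exp, Real.exp_le_one_iff]; simpa
  constructor
  · have h := Convex.norm_image_sub_le_of_norm_hasDerivWithin_le (𝕜 := ℂ)
      (f := fun v => exp (-v)) (f' := fun v => -exp (-v)) (s := {v : ℂ | 0 ≤ v.re}) (C := 1)
      (x := 0) (y := w)
      (fun v _ => by
        simpa using ((hasDerivAt_id v).neg.cexp).hasDerivWithinAt)
      (fun v hv => by rw [norm_neg]; exact hexp hv)
      (convex_halfSpace_re_ge 0) (by simp) hw
    simp only [neg_zero, exp_zero, sub_zero, one_mul] at h
    rwa [norm_sub_rev]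
  · calc ‖1 - exp (-w)‖ ≤ ‖(1 : ℂ)‖ + ‖exp (-w)‖ := norm_sub_le _ _
      _ ≤ 2 := by rw [norm_one]; linarith [hexp hw]

open Complex in
theorem norm_fourier_dampedDiff_le {f : ℕ → ℝ} (hf : IsComplMult f)
    (hb : ∀ n : ℕ, 0 < n → -1 ≤ f n ∧ f n ≤ 1) {z X : ℝ} (hz : 1 ≤ z) (hX : 1 ≤ X) (ξ : ℝ) :
    ‖𝓕 (fun v => (dampedDiff f z (1 / X) v : ℂ)) ξ‖ ≤
      2 * (2 + Real.log z) * (4 * X) ^ (17 / 24 : ℝ) / Real.Gamma (2 / 3) *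
        ‖𝓕 (fun v : ℝ => (gammaKernel v : ℂ)) ξ‖ := by
  have hX0 : 0 < X := by linarith
  set σ := 1 / X with hσd
  have hσ : 0 < σ := by positivity
  have hb' : ∀ n : ℕ, 0 < n → |f n| ≤ 1 := fun n hn => abs_le.mpr (hb n hn)
  set y : ℝ := 2 * Real.pi * ξ with hy
  set ℓ := Real.log z with hℓ
  have hℓ0 : 0 ≤ ℓ := Real.log_nonneg hz
  set s : ℂ := 1 + σ + y * I with hs
  set s' : ℂ := 1 + σ + 2 * y * I with hs'
  have hsre : s.re = 1 + σ := by simp [hs]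
  have hsim : s.im = y := by simp [hs]
  have hs're : s'.re = 1 + σ := by simp [hs']
  have hs'im : s'.im = 2 * y := by simp [hs']
  have hsn : 0 < ‖s‖ := by
    apply norm_pos_iff.mpr
    intro h
    have : s.re = 0 := by rw [h]; simp
    linarith
  set q := ‖1 - exp (-((σ + y * I) * ℓ))‖ with hq
  have hq0 : 0 ≤ q := norm_nonneg _
  obtain ⟨hq1, hq2⟩ := norm_one_sub_exp_neg_le (w := (σ + y * I) * ℓ) (by
    simp only [add_re, ofReal_re, mul_re, I_re, I_im, ofReal_im]
    simp only [mul_zero, zero_mul, sub_zero, add_zero]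
    positivity)
  rw [← hq] at hq1 hq2
  have hu : ‖(σ + y * I : ℂ)‖ ≤ ‖s' - 1‖ := by
    rw [norm_def, norm_def]
    apply Real.sqrt_le_sqrt
    simp only [normSq_apply, sub_re, sub_im, hs're, hs'im]
    simp
    nlinarith [sq_nonneg y]
  have hs'n : ‖s'‖ ≤ 2 * ‖s‖ := by
    rw [norm_def, norm_def, ← Real.sqrt_sq (show (0 : ℝ) ≤ 2 by norm_num),
      ← Real.sqrt_mul (by positivity)]
    apply Real.sqrt_le_sqrt
    simp only [normSq_apply, hsre, hsim, hs're, hs'im]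
    nlinarith [sq_nonneg (1 + σ)]
  have hs'1 : 0 < ‖s' - 1‖ := by
    refine lt_of_lt_of_le ?_ hu
    apply norm_pos_iff.mpr
    intro h
    have : (σ + y * I : ℂ).re = 0 := by rw [h]; simp
    simp at this
    linarith
  have hzeta' : ‖riemannZeta s'‖ ≤ ‖s'‖ * (1 + 1 / ‖s' - 1‖) :=
    norm_riemannZeta_le (by rw [hs're]; linarith)
  have hzeta : ‖riemannZeta (1 + σ)‖ ≤ 4 * X := by
    refine (norm_riemannZeta_le (s := 1 + σ) (by simp [hσ])).trans ?_
    have h1 : (1 + σ : ℂ) = ((1 + σ : ℝ) : ℂ) := by push_cast; rfl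
    rw [add_sub_cancel_left, h1, norm_real, norm_real, Real.norm_of_nonneg (by positivity),
      Real.norm_of_nonneg hσ.le, hσd]
    have : 1 / X ≤ 1 := by rw [div_le_one hX0]; exact hX
    calc (1 + 1 / X) * (1 + 1 / (1 / X)) ≤ (1 + 1) * (1 + 1 / (1 / X)) := by gcongr
      _ ≤ 4 * X := by rw [one_div_one_div]; linarith
  have hcube : q ^ 3 * ‖riemannZeta s'‖ ≤ 8 * (2 + ℓ) * ‖s‖ := by
    have h2 : q * (1 + 1 / ‖s' - 1‖) ≤ 2 + ℓ := by
      rw [mul_add, mul_one]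
      gcongr
      rw [mul_one_div, div_le_iff₀ hs'1]
      calc q ≤ ‖(σ + y * I) * (ℓ : ℂ)‖ := hq1
        _ = ‖(σ + y * I : ℂ)‖ * ℓ := by rw [norm_mul, norm_real, Real.norm_of_nonneg hℓ0]
        _ ≤ ‖s' - 1‖ * ℓ := by gcongr
        _ = _ := mul_comm _ _
    calc q ^ 3 * ‖riemannZeta s'‖ ≤ (2 ^ 2 * q) * (‖s'‖ * (1 + 1 / ‖s' - 1‖)) := by
          gcongr
          calc q ^ 3 = q ^ 2 * q := by ring
            _ ≤ _ := by gcongr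
      _ = 4 * ‖s'‖ * (q * (1 + 1 / ‖s' - 1‖)) := by ring
      _ ≤ 4 * (2 * ‖s‖) * (2 + ℓ) := by gcongr
      _ = _ := by ring
  have hroot : q * ‖riemannZeta s'‖ ^ (1 / 3 : ℝ) ≤ 2 * (2 + ℓ) * ‖s‖ ^ (1 / 3 : ℝ) := by
    have h3 : q = (q ^ 3) ^ (1 / 3 : ℝ) := by
      rw [← Real.rpow_natCast, ← Real.rpow_mul hq0]; norm_num
    have h8 : (8 : ℝ) ^ (1 / 3 : ℝ) = 2 := by
      rw [show (8 : ℝ) = 2 ^ (3 : ℝ) by norm_num, ← Real.rpow_mul (by norm_num)]; norm_num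
    rw [h3, ← Real.mul_rpow (by positivity) (norm_nonneg _)]
    calc _ ≤ (8 * (2 + ℓ) * ‖s‖) ^ (1 / 3 : ℝ) := by gcongr
      _ = 2 * (2 + ℓ) ^ (1 / 3 : ℝ) * ‖s‖ ^ (1 / 3 : ℝ) := by
        rw [Real.mul_rpow (by positivity) hsn.le, Real.mul_rpow (by norm_num) (by positivity), h8]
      _ ≤ _ := by
        gcongr
        calc (2 + ℓ) ^ (1 / 3 : ℝ) ≤ (2 + ℓ) ^ (1 : ℝ) :=
              Real.rpow_le_rpow_of_exponent_le (by linarith) (by norm_num)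
          _ = _ := Real.rpow_one _
  have hF := fourier_dampedMean hb' hσ ξ
  rw [← hy, ← hs] at hF
  have hF' : ‖𝓕 (fun v => (dampedMean f σ v : ℂ)) ξ‖ ≤
      ((4 * X) ^ (17 / 24 : ℝ) * ‖riemannZeta s'‖ ^ (1 / 3 : ℝ)) / ‖s‖ := by
    rw [le_div_iff₀ hsn, mul_comm, ← norm_mul, hF]
    refine (norm_LSeries_le_zeta hf hb hσ).trans ?_
    gcongr
  have hone : 0 < ‖(1 + y * I : ℂ)‖ ∧ ‖(1 + y * I : ℂ)‖ ≤ ‖s‖ := by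
    constructor
    · apply norm_pos_iff.mpr
      intro h
      have : (1 + y * I : ℂ).re = 0 := by rw [h]; simp
      simp at this
    · rw [norm_def, norm_def]
      apply Real.sqrt_le_sqrt
      simp only [normSq_apply, hsre, hsim]
      simp
      nlinarith
  have hG : 0 < Real.Gamma (2 / 3) := Real.Gamma_pos_of_pos (by norm_num)
  have hcast : (2 * Real.pi * ξ * I : ℂ) = y * I := by rw [hy]; push_cast; ring
  rw [fourier_dampedDiff hb' hσ hz, norm_mul, ← hy, ← hℓ, ← hq, norm_fourier_gammaKernel, hcast,
    ← mul_assoc, div_mul_cancel₀ _ hG.ne']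
  calc q * ‖𝓕 (fun v => (dampedMean f σ v : ℂ)) ξ‖
      ≤ q * (((4 * X) ^ (17 / 24 : ℝ) * ‖riemannZeta s'‖ ^ (1 / 3 : ℝ)) / ‖s‖) := by gcongr
    _ = (4 * X) ^ (17 / 24 : ℝ) * (q * ‖riemannZeta s'‖ ^ (1 / 3 : ℝ)) / ‖s‖ := by ring
    _ ≤ (4 * X) ^ (17 / 24 : ℝ) * (2 * (2 + ℓ) * ‖s‖ ^ (1 / 3 : ℝ)) / ‖s‖ := by gcongr
    _ = 2 * (2 + ℓ) * (4 * X) ^ (17 / 24 : ℝ) * ‖s‖ ^ (-(2 / 3) : ℝ) := by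
        rw [show (-(2 / 3) : ℝ) = 1 / 3 - 1 by norm_num, Real.rpow_sub hsn, Real.rpow_one]
        ring
    _ ≤ _ := by
        gcongr ?_ * ?_
        exact Real.rpow_le_rpow_of_nonpos hone.1 hone.2 (by norm_num)

/-- The weighted sums over translates of the damped variation are bounded in mean square. -/
theorem exists_integral_norm_sq_sum_dampedDiff_le :
    ∃ C : ℝ, 0 < C ∧ ∀ f : ℕ → ℝ, IsComplMult f → (∀ n : ℕ, 0 < n → -1 ≤ f n ∧ f n ≤ 1) →
      ∀ z X : ℝ, 1 ≤ z → 1 ≤ X → ∀ (s : Finset ℕ) (a l : ℕ → ℝ),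
        ∫ v, (∑ n ∈ s, a n * dampedDiff f z (1 / X) (v - l n)) ^ 2 ≤
          (C * (1 + Real.log z) * X ^ (17 / 24 : ℝ)) ^ 2 *
            ∑ n ∈ s, ∑ m ∈ s, |a n| * |a m| * Real.exp (-|l n - l m|) := by
  set A := ∫ v, gammaKernel v ^ 2
  have hA : 0 ≤ A := integral_nonneg fun v => sq_nonneg _
  have hG : 0 < Real.Gamma (2 / 3) := Real.Gamma_pos_of_pos (by norm_num)
  refine ⟨4 * 4 ^ (17 / 24 : ℝ) / Real.Gamma (2 / 3) * Real.sqrt (A + 1), by positivity, ?_⟩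
  intro f hf hb z X hz hX s a l
  have hℓ0 : 0 ≤ Real.log z := Real.log_nonneg hz
  obtain ⟨hw1, hw2⟩ := dampedDiff_memLp (f := f) (σ := 1 / X)
    (fun n hn => abs_le.mpr (hb n hn)) (by positivity) hz
  have h := integral_norm_sq_sum_translates_le hw1 hw2 integrable_gammaKernel.ofReal
    memLp_two_gammaKernel (norm_fourier_dampedDiff_le hf hb hz hX) s (fun n => (a n : ℂ)) l
  have h2 := integral_norm_sq_sum_gammaKernel_le s (fun n => (a n : ℂ)) l
  simp only [Complex.norm_real, Real.norm_eq_abs] at h2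
  have h3 : ∀ v, ‖∑ n ∈ s, (a n : ℂ) * (dampedDiff f z (1 / X) (v - l n) : ℂ)‖ ^ 2 =
      (∑ n ∈ s, a n * dampedDiff f z (1 / X) (v - l n)) ^ 2 := by
    intro v
    rw [← sq_abs (∑ n ∈ s, _), ← Real.norm_eq_abs, ← Complex.norm_real]
    push_cast
    rfl
  simp only [h3] at h
  have hS : 0 ≤ ∑ n ∈ s, ∑ m ∈ s, |a n| * |a m| * Real.exp (-|l n - l m|) := by positivity
  refine h.trans ((mul_le_mul_of_nonneg_left h2 (sq_nonneg _)).trans ?_)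
  rw [← mul_assoc]
  gcongr
  have h5 : (4 * 4 ^ (17 / 24 : ℝ) / Real.Gamma (2 / 3) * Real.sqrt (A + 1) *
      (1 + Real.log z) * X ^ (17 / 24 : ℝ)) ^ 2 = (4 * (1 + Real.log z) * (4 * X) ^ (17 / 24 : ℝ) /
        Real.Gamma (2 / 3)) ^ 2 * (A + 1) := by
    have h6 := Real.sq_sqrt (show 0 ≤ A + 1 by positivity)
    rw [Real.mul_rpow (by norm_num) (by linarith)]
    generalize Real.sqrt (A + 1) = b at h6 ⊢
    rw [← h6]
    ring
  rw [h5]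
  have h7 : 2 * (2 + Real.log z) ≤ 4 * (1 + Real.log z) := by linarith
  have h8 : A ≤ A + 1 := by linarith
  gcongr

end

section

open Finset ArithmeticFunction

theorem psi_eq_sum_Icc_one (x : ℝ) : Chebyshev.psi x = ∑ n ∈ Icc 1 ⌊x⌋₊, Λ n := rfl

theorem sum_Icc_sum_divisorsAntidiagonal {M : Type*} [AddCommMonoid M] (x : ℝ) (h : ℕ → ℕ → M) :
    ∑ n ∈ Icc 1 ⌊x⌋₊, ∑ p ∈ n.divisorsAntidiagonal, h p.1 p.2 =
      ∑ d ∈ Icc 1 ⌊x⌋₊, ∑ m ∈ Icc 1 ⌊x / d⌋₊, h d m := by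
  rw [sum_sigma', sum_sigma']
  refine sum_bij' (fun a _ => ⟨a.2.1, a.2.2⟩) (fun b _ => ⟨b.1 * b.2, (b.1, b.2)⟩) ?_ ?_ ?_ ?_ ?_
  · rintro ⟨n, d, m⟩ hn
    simp only [mem_sigma, mem_Icc, Nat.mem_divisorsAntidiagonal, Nat.floor_div_natCast] at hn ⊢
    obtain ⟨⟨h1, h2⟩, rfl, h3⟩ := hn
    have hd : 0 < d := Nat.pos_of_ne_zero (left_ne_zero_of_mul h3)
    have hm : 0 < m := Nat.pos_of_ne_zero (right_ne_zero_of_mul h3)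
    refine ⟨⟨hd, (Nat.le_mul_of_pos_right d hm).trans h2⟩, hm, ?_⟩
    rwa [Nat.le_div_iff_mul_le hd, mul_comm]
  · rintro ⟨d, m⟩ hd
    simp only [mem_sigma, mem_Icc, Nat.mem_divisorsAntidiagonal, Nat.floor_div_natCast] at hd ⊢
    obtain ⟨⟨h1, h2⟩, h3, h4⟩ := hd
    rw [Nat.le_div_iff_mul_le h1, mul_comm] at h4
    exact ⟨⟨Nat.mul_pos h1 h3, h4⟩, trivial, (Nat.mul_pos h1 h3).ne'⟩
  · rintro ⟨n, d, m⟩ hn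
    simp only [mem_sigma, Nat.mem_divisorsAntidiagonal] at hn
    obtain ⟨-, rfl, -⟩ := hn
    rfl
  · rintro ⟨d, m⟩ _
    rfl
  · rintro ⟨n, d, m⟩ _
    rfl

theorem floor_pos_of_mem {x : ℝ} {n : ℕ} (hn : n ∈ Icc 1 ⌊x⌋₊) :
    1 ≤ n ∧ (1 : ℝ) ≤ n ∧ (n : ℝ) ≤ x ∧ 1 ≤ x / n := by
  obtain ⟨h1, h2⟩ := mem_Icc.mp hn
  have h3 : (1 : ℝ) ≤ n := by exact_mod_cast h1
  have h4 : (n : ℝ) ≤ x := (Nat.le_floor_iff' (by omega)).mp h2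
  exact ⟨h1, h3, h4, by rw [one_le_div (by linarith)]; exact h4⟩

theorem sum_mul_log_le {a : ℕ → ℝ} {c : ℝ} (ha : ∀ n, 0 ≤ a n)
    (hs : ∀ k : ℕ, ∑ n ∈ Icc 1 k, a n ≤ c * k) {x : ℝ} (hx : 1 ≤ x) :
    ∑ n ∈ Icc 1 ⌊x⌋₊, a n * Real.log (x / n) ≤ c * x := by
  have hc : 0 ≤ c := by
    have := hs 1
    simp at this
    linarith [ha 1]
  have hlog (N : ℕ) {n : ℕ} (hn : 1 ≤ n) (hN : n ≤ N) :
      Real.log ((N + 1 : ℝ) / n) ≤ ∑ k ∈ Icc n N, (1 : ℝ) / k := by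
    induction N, hN using Nat.le_induction with
    | base =>
      have h0 : (0 : ℝ) < n := by exact_mod_cast hn
      have := Real.log_le_sub_one_of_pos (show 0 < (n + 1 : ℝ) / n by positivity)
      simp only [Icc_self, sum_singleton]
      calc _ ≤ (n + 1 : ℝ) / n - 1 := this
        _ = 1 / n := by field_simp; ring
    | succ N hN ih =>
      have h0 : (0 : ℝ) < n := by exact_mod_cast hn
      rw [sum_Icc_succ_top (by omega)]
      have := Real.log_le_sub_one_of_pos (show 0 < (N + 1 + 1 : ℝ) / (N + 1) by positivity)
      have h2 : ((N + 1 + 1 : ℝ) / n) = (N + 1 + 1 : ℝ) / (N + 1) * ((N + 1) / n) := by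
        field_simp
      push_cast
      rw [h2, Real.log_mul (by positivity) (by positivity)]
      have h3 : (N + 1 + 1 : ℝ) / (N + 1) - 1 = 1 / (N + 1) := by field_simp; ring
      linarith
  set N := ⌊x⌋₊
  have hxN : x ≤ N + 1 := (Nat.lt_floor_add_one x).le
  calc ∑ n ∈ Icc 1 N, a n * Real.log (x / n)
      ≤ ∑ n ∈ Icc 1 N, ∑ k ∈ Icc n N, a n * (1 / k) := by
        refine sum_le_sum fun n hn => ?_
        obtain ⟨h1, h2, h3, h4⟩ := floor_pos_of_mem hn
        rw [← mul_sum]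
        refine mul_le_mul_of_nonneg_left (le_trans ?_ (hlog N h1 (mem_Icc.mp hn).2)) (ha n)
        apply Real.log_le_log (by positivity)
        gcongr
    _ = ∑ k ∈ Icc 1 N, ∑ n ∈ Icc 1 k, a n * (1 / k) := by
        apply sum_comm'
        intro n k
        simp only [mem_Icc]
        omega
    _ ≤ ∑ k ∈ Icc 1 N, c := by
        refine sum_le_sum fun k hk => ?_
        have h0 : (0 : ℝ) < k := by exact_mod_cast (mem_Icc.mp hk).1
        rw [← sum_mul, mul_one_div, div_le_iff₀ h0]
        exact hs k
    _ = c * N := by simp [mul_comm]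
    _ ≤ c * x := by gcongr; exact Nat.floor_le (by linarith)

theorem sum_log_div_le {x : ℝ} (hx : 1 ≤ x) : ∑ n ∈ Icc 1 ⌊x⌋₊, Real.log (x / n) ≤ x := by
  simpa using sum_mul_log_le (a := fun _ => 1) (c := 1) (by simp) (by simp) hx

theorem sum_vonMangoldt_Icc_le (k : ℕ) : ∑ n ∈ Icc 1 k, Λ n ≤ (Real.log 4 + 4) * k := by
  simpa [psi_eq_sum_Icc_one] using Chebyshev.psi_le_const_mul_self (x := k) (by positivity)

theorem sum_vonMangoldt_mul_log_div_le {x : ℝ} (hx : 1 ≤ x) :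
    ∑ n ∈ Icc 1 ⌊x⌋₊, Λ n * Real.log (x / n) ≤ (Real.log 4 + 4) * x :=
  sum_mul_log_le (fun _ => vonMangoldt_nonneg) sum_vonMangoldt_Icc_le hx

theorem le_sum_log_div {x : ℝ} (hx : 1 ≤ x) :
    x - 2 - Real.log x ≤ ∑ n ∈ Icc 1 ⌊x⌋₊, Real.log (x / n) := by
  have key (N : ℕ) (hN : 1 ≤ N) :
      ∑ n ∈ Icc 1 N, Real.log n ≤ (N + 1) * Real.log N + 1 - N := by
    induction N, hN using Nat.le_induction with
    | base => simp
    | succ N hN ih =>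
      have h0 : (0 : ℝ) < N := by exact_mod_cast hN
      rw [sum_Icc_succ_top (by omega)]
      have := Real.log_le_sub_one_of_pos (show 0 < (N : ℝ) / (N + 1) by positivity)
      rw [Real.log_div (by positivity) (by positivity)] at this
      have h3 : (N : ℝ) / (N + 1) - 1 = -1 / (N + 1) := by field_simp; ring
      rw [h3, le_div_iff₀ (by positivity)] at this
      push_cast
      nlinarith
  have hN : 1 ≤ ⌊x⌋₊ := by rwa [Nat.one_le_floor_iff]
  have h1 : ∑ n ∈ Icc 1 ⌊x⌋₊, Real.log (x / n) =
      ⌊x⌋₊ * Real.log x - ∑ n ∈ Icc 1 ⌊x⌋₊, Real.log n := by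
    rw [sum_congr rfl fun n hn => Real.log_div (by linarith)
      (by linarith [(floor_pos_of_mem hn).2.1]), sum_sub_distrib]
    simp
  have h2 := key _ hN
  have h3 : (1 : ℝ) ≤ ⌊x⌋₊ := by exact_mod_cast hN
  have h4 : Real.log ⌊x⌋₊ ≤ Real.log x :=
    Real.log_le_log (by linarith) (Nat.floor_le (by linarith))
  have h5 := Nat.lt_floor_add_one x
  rw [h1]
  nlinarith

theorem sum_log_eq_sum_vonMangoldt (x : ℝ) :
    ∑ n ∈ Icc 1 ⌊x⌋₊, Real.log n = ∑ d ∈ Icc 1 ⌊x⌋₊, Λ d * ⌊x / d⌋₊ := by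
  have h := sum_Icc_sum_divisorsAntidiagonal x fun d _ => Λ d
  simp only [sum_const, Nat.card_Icc, Nat.add_sub_cancel, nsmul_eq_mul] at h
  rw [sum_congr rfl fun d _ => mul_comm (Λ d) _, ← h]
  refine sum_congr rfl fun n _ => ?_
  rw [Nat.sum_divisorsAntidiagonal (fun d _ => Λ d), vonMangoldt_sum]

theorem sum_log_eq {x : ℝ} (hx : 1 ≤ x) : ∑ n ∈ Icc 1 ⌊x⌋₊, Real.log n =
    ⌊x⌋₊ * Real.log x - ∑ n ∈ Icc 1 ⌊x⌋₊, Real.log (x / n) := by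
  rw [sum_congr rfl fun n hn => Real.log_div (by linarith)
    (by linarith [(floor_pos_of_mem hn).2.1]), sum_sub_distrib]
  simp

/-- Mertens' first theorem. -/
theorem abs_sum_vonMangoldt_div_sub_log_le {x : ℝ} (hx : 1 ≤ x) :
    |∑ n ∈ Icc 1 ⌊x⌋₊, Λ n / n - Real.log x| ≤ Real.log 4 + 4 := by
  have hT := sum_log_eq_sum_vonMangoldt x
  rw [sum_log_eq hx] at hT
  have h0 : 0 ≤ ∑ n ∈ Icc 1 ⌊x⌋₊, Real.log (x / n) :=
    sum_nonneg fun n hn => Real.log_nonneg (floor_pos_of_mem hn).2.2.2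
  have h1 := sum_log_div_le hx
  have h2 := Nat.floor_le (show 0 ≤ x by linarith)
  have h3 := Nat.lt_floor_add_one x
  have hl := Real.log_nonneg hx
  have hl2 := Real.log_le_sub_one_of_pos (show 0 < x by linarith)
  have h4 : ∑ d ∈ Icc 1 ⌊x⌋₊, Λ d * ⌊x / d⌋₊ ≤ x * ∑ n ∈ Icc 1 ⌊x⌋₊, Λ n / n := by
    rw [mul_sum]
    refine sum_le_sum fun d hd => ?_
    have := Nat.floor_le (show 0 ≤ x / d by linarith [(floor_pos_of_mem hd).2.2.2])
    calc Λ d * ⌊x / d⌋₊ ≤ Λ d * (x / d) := mul_le_mul_of_nonneg_left this vonMangoldt_nonneg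
      _ = x * (Λ d / d) := by ring
  have h5 : x * ∑ n ∈ Icc 1 ⌊x⌋₊, Λ n / n ≤
      ∑ d ∈ Icc 1 ⌊x⌋₊, Λ d * ⌊x / d⌋₊ + (Real.log 4 + 4) * x := by
    have h6 : ∑ d ∈ Icc 1 ⌊x⌋₊, Λ d ≤ (Real.log 4 + 4) * x :=
      (sum_vonMangoldt_Icc_le _).trans (by gcongr)
    refine le_trans ?_ (add_le_add_right h6 _)
    rw [mul_sum, ← sum_add_distrib]
    refine sum_le_sum fun d hd => ?_
    have := (Nat.lt_floor_add_one (x / d)).le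
    calc x * (Λ d / d) = Λ d * (x / d) := by ring
      _ ≤ Λ d * (⌊x / d⌋₊ + 1) := mul_le_mul_of_nonneg_left this vonMangoldt_nonneg
      _ = _ := by ring
  have h4' : 0 ≤ Real.log 4 := Real.log_nonneg (by norm_num)
  have hx0 : 0 < x := by linarith
  rw [abs_le]
  constructor
  · refine le_of_mul_le_mul_left ?_ hx0
    nlinarith
  · refine le_of_mul_le_mul_left ?_ hx0
    nlinarith

theorem sum_vonMangoldt_div_le {x : ℝ} (hx : 1 ≤ x) :
    ∑ n ∈ Icc 1 ⌊x⌋₊, Λ n / n ≤ Real.log x + (Real.log 4 + 4) := by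
  linarith [(abs_le.mp (abs_sum_vonMangoldt_div_sub_log_le hx)).2]

theorem sum_sum_vonMangoldt_mul_exp_le {x : ℝ} (hx : 1 ≤ x) :
    ∑ n ∈ Icc 1 ⌊x⌋₊, ∑ m ∈ Icc 1 ⌊x⌋₊, (Λ n / n) * (Λ m / m) *
        Real.exp (-|Real.log n - Real.log m|) ≤
      2 * (Real.log 4 + 4) * (Real.log x + (Real.log 4 + 4)) := by
  set N := ⌊x⌋₊
  have hterm : ∀ n ∈ Icc 1 N, ∀ m ∈ Icc 1 N, (Λ n / n) * (Λ m / m) *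
      Real.exp (-|Real.log n - Real.log m|) ≤
      (if n ≤ m then Λ n * (Λ m / m ^ 2) else 0) + (if m ≤ n then Λ m * (Λ n / n ^ 2) else 0) := by
    have key {n m : ℕ} (hn : 1 ≤ n) (hm : 1 ≤ m) (hnm : n ≤ m) : (Λ n / n) * (Λ m / m) *
        Real.exp (-|Real.log n - Real.log m|) = Λ n * (Λ m / m ^ 2) := by
      have hn0 : (0 : ℝ) < n := by exact_mod_cast hn
      have hm0 : (0 : ℝ) < m := by exact_mod_cast hm
      have : Real.log n ≤ Real.log m := Real.log_le_log hn0 (by exact_mod_cast hnm)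
      rw [abs_of_nonpos (by linarith), neg_neg, Real.exp_sub, Real.exp_log hn0, Real.exp_log hm0]
      field_simp
    intro n hn m hm
    have hn := (mem_Icc.mp hn).1
    have hm := (mem_Icc.mp hm).1
    have hpos (a b : ℕ) : 0 ≤ Λ a * (Λ b / b ^ 2) :=
      mul_nonneg vonMangoldt_nonneg (div_nonneg vonMangoldt_nonneg (by positivity))
    rcases le_total n m with h | h
    · rw [key hn hm h, if_pos h]
      split_ifs <;> simp [hpos]
    · rw [mul_comm (Λ n / n), abs_sub_comm, key hm hn h, if_pos h]
      split_ifs <;> simp [hpos]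
  have hhalf : ∑ m ∈ Icc 1 N, ∑ n ∈ Icc 1 N, (if n ≤ m then Λ n * (Λ m / m ^ 2) else 0) ≤
      (Real.log 4 + 4) * (Real.log x + (Real.log 4 + 4)) := by
    calc _ ≤ ∑ m ∈ Icc 1 N, (Real.log 4 + 4) * (Λ m / m) := by
          refine sum_le_sum fun m hm => ?_
          obtain ⟨hm1, hm2⟩ := mem_Icc.mp hm
          have hm0 : (0 : ℝ) < m := by exact_mod_cast hm1
          rw [← sum_filter, ← sum_mul]
          have : (Icc 1 N).filter (fun n => n ≤ m) = Icc 1 m := by ext; simp; omega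
          rw [this]
          calc _ ≤ ((Real.log 4 + 4) * m) * (Λ m / m ^ 2) :=
                mul_le_mul_of_nonneg_right (sum_vonMangoldt_Icc_le m)
                  (div_nonneg vonMangoldt_nonneg (by positivity))
            _ = _ := by field_simp
      _ ≤ _ := by
          rw [← mul_sum]
          gcongr
          exact sum_vonMangoldt_div_le hx
  calc _ ≤ ∑ n ∈ Icc 1 N, ∑ m ∈ Icc 1 N, ((if n ≤ m then Λ n * (Λ m / m ^ 2) else 0) +
        (if m ≤ n then Λ m * (Λ n / n ^ 2) else 0)) :=
        sum_le_sum fun n hn => sum_le_sum fun m hm => hterm n hn m hm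
    _ = ∑ m ∈ Icc 1 N, ∑ n ∈ Icc 1 N, (if n ≤ m then Λ n * (Λ m / m ^ 2) else 0) +
        ∑ n ∈ Icc 1 N, ∑ m ∈ Icc 1 N, (if m ≤ n then Λ m * (Λ n / n ^ 2) else 0) := by
        simp only [sum_add_distrib]
        congr 1
        exact sum_comm
    _ ≤ _ := by linarith

end

section

open Finset ArithmeticFunction ArithmeticFunction.Moebius

theorem abs_sum_one_div_sub_log_sub_le {x : ℝ} (hx : 1 ≤ x) :
    |∑ n ∈ Icc 1 ⌊x⌋₊, (1 : ℝ) / n - Real.log x - Real.eulerMascheroniConstant| ≤ 2 / x := by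
  have hx0 : 0 < x := by linarith
  have hN : 1 ≤ ⌊x⌋₊ := by rwa [Nat.one_le_floor_iff]
  have hN1 : (1 : ℝ) ≤ ⌊x⌋₊ := by exact_mod_cast hN
  have h1 := Real.eulerMascheroniSeq_lt_eulerMascheroniConstant ⌊x⌋₊
  have h2 := Real.eulerMascheroniConstant_lt_eulerMascheroniSeq' ⌊x⌋₊
  have hH : ((harmonic ⌊x⌋₊ : ℚ) : ℝ) = ∑ n ∈ Icc 1 ⌊x⌋₊, (1 : ℝ) / n := by
    rw [harmonic_eq_sum_Icc]; push_cast; simp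
  rw [Real.eulerMascheroniSeq, hH] at h1
  rw [Real.eulerMascheroniSeq', if_neg (by omega), hH] at h2
  have h3 := Nat.floor_le hx0.le
  have h4 := Nat.lt_floor_add_one x
  have h5 : Real.log (⌊x⌋₊ + 1) ≤ Real.log x + 1 / x := by
    have := Real.log_le_sub_one_of_pos (show 0 < (⌊x⌋₊ + 1 : ℝ) / x by positivity)
    rw [Real.log_div (by positivity) hx0.ne'] at this
    have : (⌊x⌋₊ + 1 : ℝ) / x - 1 ≤ 1 / x := by
      rw [div_sub_one hx0.ne']; gcongr; linarith
    linarith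
  have h6 : Real.log x - 2 / x ≤ Real.log ⌊x⌋₊ := by
    have := Real.log_le_sub_one_of_pos (show 0 < x / (⌊x⌋₊ : ℝ) by positivity)
    rw [Real.log_div hx0.ne' (by positivity)] at this
    have : x / (⌊x⌋₊ : ℝ) - 1 ≤ 2 / x := by
      rw [div_sub_one (by positivity), div_le_div_iff₀ (by positivity) hx0]
      nlinarith
    linarith
  have h7 : 1 / x ≤ 2 / x := by gcongr; norm_num
  rw [abs_le]
  constructor <;> linarith

theorem sum_moebius_mul_log_div {x : ℝ} (hx : 0 < x) (k : ℕ) :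
    ∑ d ∈ k.divisors, (μ d : ℝ) * Real.log (x / d) =
      (if k = 1 then Real.log x else 0) + Λ k := by
  have h1 : ∑ d ∈ k.divisors, (μ d : ℝ) = if k = 1 then 1 else 0 := by
    have := congrArg (fun g : ArithmeticFunction ℝ => g k) (coe_moebius_mul_coe_zeta (R := ℝ))
    rw [coe_mul_zeta_apply, one_apply] at this
    simpa using this
  have h2 : ∀ d ∈ k.divisors, (μ d : ℝ) * Real.log (x / d) =
      (μ d : ℝ) * Real.log x - (μ d : ℝ) * Real.log d := by
    intro d hd
    have : (d : ℝ) ≠ 0 := by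
      exact_mod_cast (Nat.pos_of_mem_divisors hd).ne'
    rw [Real.log_div hx.ne' this]
    ring
  rw [sum_congr rfl h2, sum_sub_distrib, ← sum_mul, h1]
  simp only [← log_apply]
  rw [sum_moebius_mul_log_eq]
  split_ifs <;> simp

/-- The Tatuzawa–Iseki identity. -/
theorem sum_moebius_mul_log_mul_sum (F : ℝ → ℝ) {x : ℝ} (hx : 1 ≤ x) :
    ∑ d ∈ Icc 1 ⌊x⌋₊, (μ d : ℝ) * Real.log (x / d) * ∑ m ∈ Icc 1 ⌊x / d⌋₊, F (x / d / m) =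
      F x * Real.log x + ∑ n ∈ Icc 1 ⌊x⌋₊, Λ n * F (x / n) := by
  have h := sum_Icc_sum_divisorsAntidiagonal x
    fun d m => (μ d : ℝ) * Real.log (x / d) * F (x / (d * m : ℕ))
  have h1 : ∀ n ∈ Icc 1 ⌊x⌋₊, ∑ p ∈ n.divisorsAntidiagonal,
      (μ p.1 : ℝ) * Real.log (x / p.1) * F (x / (p.1 * p.2 : ℕ)) =
      (if n = 1 then F x * Real.log x else 0) + Λ n * F (x / n) := by
    intro n _
    have : ∀ p ∈ n.divisorsAntidiagonal,
        (μ p.1 : ℝ) * Real.log (x / p.1) * F (x / (p.1 * p.2 : ℕ)) =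
        (μ p.1 : ℝ) * Real.log (x / p.1) * F (x / n) := by
      intro p hp
      rw [(Nat.mem_divisorsAntidiagonal.mp hp).1]
    rw [sum_congr rfl this, ← sum_mul,
      Nat.sum_divisorsAntidiagonal (fun d _ => (μ d : ℝ) * Real.log (x / d)),
      sum_moebius_mul_log_div (by linarith) n]
    split_ifs with h
    · subst h; simp; ring
    · simp
  rw [sum_congr rfl h1, sum_add_distrib, sum_ite_eq',
    if_pos (by simpa using hx)] at h
  rw [h]
  refine sum_congr rfl fun d _ => ?_
  rw [mul_sum]
  refine sum_congr rfl fun m _ => ?_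
  push_cast
  rw [div_div]

theorem sum_psi_div (y : ℝ) :
    ∑ m ∈ Icc 1 ⌊y⌋₊, Chebyshev.psi (y / m) = ∑ n ∈ Icc 1 ⌊y⌋₊, Real.log n := by
  have h := sum_Icc_sum_divisorsAntidiagonal y fun _ m => Λ m
  simp only [psi_eq_sum_Icc_one]
  rw [← h]
  refine sum_congr rfl fun n _ => ?_
  rw [Nat.sum_divisorsAntidiagonal' (fun _ m => Λ m), vonMangoldt_sum]

theorem abs_sum_psi_sub_le {y : ℝ} (hy : 1 ≤ y) :
    |∑ m ∈ Icc 1 ⌊y⌋₊, (Chebyshev.psi (y / m) - y / m + (Real.eulerMascheroniConstant + 1))| ≤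
      6 + 2 * Real.log y := by
  have hy0 : 0 < y := by linarith
  set γ := Real.eulerMascheroniConstant
  have h1 := abs_le.mp (abs_sum_one_div_sub_log_sub_le hy)
  have h2 := le_sum_log_div hy
  have h3 := sum_log_div_le hy
  have h4 := Nat.floor_le hy0.le
  have h5 := Nat.lt_floor_add_one y
  have hl := Real.log_nonneg hy
  have hγ1 : 1 / 2 < γ := Real.one_half_lt_eulerMascheroniConstant
  have hγ2 : γ < 2 / 3 := Real.eulerMascheroniConstant_lt_two_thirds
  have h6 : ∑ m ∈ Icc 1 ⌊y⌋₊, y / (m : ℝ) = y * ∑ n ∈ Icc 1 ⌊y⌋₊, (1 : ℝ) / n := by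
    rw [mul_sum]; simp [div_eq_mul_inv]
  rw [sum_add_distrib, sum_sub_distrib, sum_psi_div, h6, sum_log_eq hy]
  simp only [sum_const, Nat.card_Icc, Nat.add_sub_cancel, nsmul_eq_mul]
  set H := ∑ n ∈ Icc 1 ⌊y⌋₊, (1 : ℝ) / n
  set T := ∑ n ∈ Icc 1 ⌊y⌋₊, Real.log (y / n)
  have e1 : y * (2 / y) = 2 := by field_simp
  have e2 : y * (H - Real.log y - γ) ≤ 2 := by
    rw [← e1]; exact mul_le_mul_of_nonneg_left h1.2 hy0.le
  have e3 : -2 ≤ y * (H - Real.log y - γ) := by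
    rw [← e1, ← mul_neg]; exact mul_le_mul_of_nonneg_left h1.1 hy0.le
  have e4 : (⌊y⌋₊ : ℝ) * Real.log y ≤ y * Real.log y := by gcongr
  have e5 : (y - 1) * Real.log y ≤ ⌊y⌋₊ * Real.log y := by gcongr; linarith
  have e6 : (⌊y⌋₊ : ℝ) * (γ + 1) ≤ y * (γ + 1) := by gcongr
  have e7 : (y - 1) * (γ + 1) ≤ ⌊y⌋₊ * (γ + 1) := by gcongr; linarith
  rw [abs_le]
  constructor <;> nlinarith

theorem sum_one_div_sqrt_le (N : ℕ) : ∑ n ∈ Icc 1 N, 1 / √(n : ℝ) ≤ 2 * √(N : ℝ) := by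
  induction N with
  | zero => simp
  | succ N ih =>
    rw [sum_Icc_succ_top (by omega)]
    push_cast
    set a := √(N : ℝ)
    set b := √((N : ℝ) + 1)
    have hb : 0 < b := by positivity
    have ha : 0 ≤ a := by positivity
    have h1 : a ^ 2 = N := Real.sq_sqrt (by positivity)
    have h2 : b ^ 2 = N + 1 := Real.sq_sqrt (by positivity)
    have : 1 / b ≤ 2 * b - 2 * a := by
      rw [div_le_iff₀ hb]
      nlinarith [sq_nonneg (b - a)]
    linarith

theorem abs_psi_selberg_le {x : ℝ} (hx : 1 ≤ x) :
    |(Chebyshev.psi x - x + (Real.eulerMascheroniConstant + 1)) * Real.log x +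
      ∑ n ∈ Icc 1 ⌊x⌋₊,
        Λ n * (Chebyshev.psi (x / n) - x / n + (Real.eulerMascheroniConstant + 1))| ≤ 88 * x := by
  have hx0 : 0 < x := by linarith
  rw [← sum_moebius_mul_log_mul_sum
    (fun t => Chebyshev.psi t - t + (Real.eulerMascheroniConstant + 1)) hx]
  have hterm : ∀ d ∈ Icc 1 ⌊x⌋₊, |(μ d : ℝ) * Real.log (x / d) * ∑ m ∈ Icc 1 ⌊x / d⌋₊,
      (Chebyshev.psi (x / d / m) - x / d / m + (Real.eulerMascheroniConstant + 1))| ≤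
      44 * √x * (1 / √d) := by
    intro d hd
    obtain ⟨-, h1, -, h2⟩ := floor_pos_of_mem hd
    have hd0 : (0 : ℝ) < d := by linarith
    have hμ : |(μ d : ℝ)| ≤ 1 := by
      rw [← Int.cast_abs]; exact_mod_cast abs_moebius_le_one
    set y := x / d with hy
    have hy0 : 0 < y := by linarith
    have hl := Real.log_nonneg h2
    have hl1 : Real.log y ≤ 2 * √y := by
      have := Real.log_le_rpow_div hy0.le (show (0 : ℝ) < 1 / 2 by norm_num)
      rw [← Real.sqrt_eq_rpow] at this
      linarith
    have hl2 : Real.log y ≤ 4 * √(√y) := by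
      have := Real.log_le_rpow_div hy0.le (show (0 : ℝ) < 1 / 4 by norm_num)
      have e : y ^ (1 / 4 : ℝ) = √(√y) := by
        rw [Real.sqrt_eq_rpow, Real.sqrt_eq_rpow, ← Real.rpow_mul hy0.le]; norm_num
      rw [e] at this
      linarith
    have hs : √(√y) ^ 2 = √y := Real.sq_sqrt (by positivity)
    have hl3 : Real.log y ^ 2 ≤ 16 * √y := by
      calc Real.log y ^ 2 ≤ (4 * √(√y)) ^ 2 := by gcongr
        _ = 16 * √y := by rw [mul_pow, hs]; norm_num
    calc _ = |(μ d : ℝ)| * Real.log y * |∑ m ∈ Icc 1 ⌊y⌋₊,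
          (Chebyshev.psi (y / m) - y / m + (Real.eulerMascheroniConstant + 1))| := by
          rw [abs_mul, abs_mul, abs_of_nonneg hl]
      _ ≤ 1 * Real.log y * (6 + 2 * Real.log y) := by
          gcongr
          exact abs_sum_psi_sub_le h2
      _ ≤ 44 * √y := by nlinarith
      _ = 44 * √x * (1 / √d) := by rw [hy, Real.sqrt_div hx0.le]; ring
  refine (abs_sum_le_sum_abs _ _).trans ((sum_le_sum hterm).trans ?_)
  rw [← mul_sum]
  calc _ ≤ 44 * √x * (2 * √x) := by
        gcongr
        refine (sum_one_div_sqrt_le _).trans ?_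
        gcongr
        exact Nat.floor_le hx0.le
    _ = 88 * x := by nlinarith [Real.mul_self_sqrt hx0.le]

/-- Selberg's function `Λ₂ = Λ log + Λ * Λ`. -/
noncomputable def selbergLambda (n : ℕ) : ℝ :=
  Λ n * Real.log n + ∑ p ∈ n.divisorsAntidiagonal, Λ p.1 * Λ p.2

theorem selbergLambda_nonneg (n : ℕ) : 0 ≤ selbergLambda n :=
  add_nonneg (mul_nonneg vonMangoldt_nonneg (Real.log_natCast_nonneg n))
    (sum_nonneg fun _ _ => mul_nonneg vonMangoldt_nonneg vonMangoldt_nonneg)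

/-- Selberg's symmetry formula. -/
theorem exists_abs_sum_selbergLambda_sub_le : ∃ C : ℝ, 0 < C ∧ ∀ x : ℝ, 1 ≤ x →
    |∑ n ∈ Icc 1 ⌊x⌋₊, selbergLambda n - 2 * x * Real.log x| ≤ C * x := by
  have hl4 : 0 ≤ Real.log 4 := Real.log_nonneg (by norm_num)
  set A := Real.log 4 + 4 with hA
  refine ⟨90 + 4 * A, by positivity, fun x hx => ?_⟩
  have hx0 : 0 < x := by linarith
  have h1 := abs_le.mp (abs_psi_selberg_le hx)
  set γ := Real.eulerMascheroniConstant
  have hγ1 : 1 / 2 < γ := Real.one_half_lt_eulerMascheroniConstant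
  have hγ2 : γ < 2 / 3 := Real.eulerMascheroniConstant_lt_two_thirds
  have h2 := abs_le.mp (abs_sum_vonMangoldt_div_sub_log_le hx)
  have h3 := sum_vonMangoldt_mul_log_div_le hx
  have h3' : 0 ≤ ∑ n ∈ Icc 1 ⌊x⌋₊, Λ n * Real.log (x / n) :=
    sum_nonneg fun n hn => mul_nonneg vonMangoldt_nonneg
      (Real.log_nonneg (floor_pos_of_mem hn).2.2.2)
  have h4 := Chebyshev.psi_le_const_mul_self hx0.le
  have h4' := Chebyshev.psi_nonneg x
  have hl := Real.log_nonneg hx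
  have hl2 := Real.log_le_sub_one_of_pos hx0
  rw [← hA] at h2 h3 h4
  have e1 : ∑ n ∈ Icc 1 ⌊x⌋₊, Λ n * (Chebyshev.psi (x / n) - x / n + (γ + 1)) =
      ∑ n ∈ Icc 1 ⌊x⌋₊, Λ n * Chebyshev.psi (x / n) - x * ∑ n ∈ Icc 1 ⌊x⌋₊, Λ n / n +
        (γ + 1) * Chebyshev.psi x := by
    rw [psi_eq_sum_Icc_one x, mul_sum, mul_sum, ← sum_sub_distrib, ← sum_add_distrib]
    refine sum_congr rfl fun n _ => ?_
    ring
  have e2 : ∑ n ∈ Icc 1 ⌊x⌋₊, Λ n * Real.log n =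
      Chebyshev.psi x * Real.log x - ∑ n ∈ Icc 1 ⌊x⌋₊, Λ n * Real.log (x / n) := by
    rw [psi_eq_sum_Icc_one, sum_mul, ← sum_sub_distrib]
    refine sum_congr rfl fun n hn => ?_
    rw [Real.log_div hx0.ne' (by linarith [(floor_pos_of_mem hn).2.1])]
    ring
  have e3 : ∑ n ∈ Icc 1 ⌊x⌋₊, ∑ p ∈ n.divisorsAntidiagonal, Λ p.1 * Λ p.2 =
      ∑ n ∈ Icc 1 ⌊x⌋₊, Λ n * Chebyshev.psi (x / n) := by
    rw [sum_Icc_sum_divisorsAntidiagonal x fun d m => Λ d * Λ m]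
    simp only [psi_eq_sum_Icc_one, mul_sum]
  simp only [selbergLambda, sum_add_distrib]
  rw [e2, e3]
  rw [e1] at h1
  set P := Chebyshev.psi x
  set Q := ∑ n ∈ Icc 1 ⌊x⌋₊, Λ n * Chebyshev.psi (x / n)
  set R := ∑ n ∈ Icc 1 ⌊x⌋₊, Λ n / n
  set U := ∑ n ∈ Icc 1 ⌊x⌋₊, Λ n * Real.log (x / n)
  have b1 : x * (R - Real.log x) ≤ x * A := mul_le_mul_of_nonneg_left h2.2 hx0.le
  have b2 : x * -A ≤ x * (R - Real.log x) := mul_le_mul_of_nonneg_left h2.1 hx0.le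
  have b3 : (γ + 1) * P ≤ 2 * (A * x) := by
    calc (γ + 1) * P ≤ 2 * P := by gcongr; linarith
      _ ≤ _ := by linarith
  have b4 : 0 ≤ (γ + 1) * P := by positivity
  have b5 : (γ + 1) * Real.log x ≤ 2 * x := by
    calc (γ + 1) * Real.log x ≤ 2 * Real.log x := by gcongr; linarith
      _ ≤ _ := by linarith
  have b6 : 0 ≤ (γ + 1) * Real.log x := by positivity
  rw [abs_le]
  constructor <;> linarith

theorem exists_sum_selbergLambda_div_le : ∃ C : ℝ, 0 < C ∧ ∀ u δ : ℝ, 1 ≤ u → 0 ≤ δ → δ ≤ 1 →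
    ∑ n ∈ Icc 1 ⌊u⌋₊ with u * Real.exp (-δ) < (n : ℕ), selbergLambda n / n ≤
      C * (1 + δ * Real.log u) := by
  obtain ⟨C, hC, h⟩ := exists_abs_sum_selbergLambda_sub_le
  refine ⟨Real.exp 1 * (2 + 2 * C), by positivity, fun u δ hu hδ hδ1 => ?_⟩
  have hu0 : 0 < u := by linarith
  have hlu := Real.log_nonneg hu
  set v := u * Real.exp (-δ) with hv
  have hv0 : 0 < v := by positivity
  have hvu : v ≤ u := by
    rw [hv]; exact mul_le_of_le_one_right hu0.le (Real.exp_le_one_iff.mpr (by linarith))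
  have hlv : Real.log v = Real.log u - δ := by
    rw [hv, Real.log_mul hu0.ne' (Real.exp_pos _).ne', Real.log_exp]; ring
  have hdiff : u - v ≤ u * δ := by
    have := Real.add_one_le_exp (-δ)
    rw [hv]; nlinarith
  have hsplit : ∑ n ∈ Icc 1 ⌊u⌋₊ with v < (n : ℕ), selbergLambda n +
      ∑ n ∈ Icc 1 ⌊v⌋₊, selbergLambda n = ∑ n ∈ Icc 1 ⌊u⌋₊, selbergLambda n := by
    rw [← sum_filter_add_sum_filter_not (Icc 1 ⌊u⌋₊) (fun n : ℕ => v < n)]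
    congr 1
    refine sum_congr ?_ fun _ _ => rfl
    ext n
    simp only [mem_Icc, mem_filter, not_lt]
    constructor
    · rintro ⟨h1, h2⟩
      exact ⟨⟨h1, h2.trans (Nat.floor_mono hvu)⟩, (Nat.le_floor_iff hv0.le).mp h2⟩
    · rintro ⟨⟨h1, -⟩, h2⟩
      exact ⟨h1, Nat.le_floor h2⟩
  have hmain : ∑ n ∈ Icc 1 ⌊u⌋₊ with v < (n : ℕ), selbergLambda n ≤
      u * ((2 + 2 * C) * (1 + δ * Real.log u)) := by
    have h1 := (abs_le.mp (h u hu)).2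
    have hδl : 0 ≤ δ * Real.log u := by positivity
    have hCl : 0 ≤ C * (δ * Real.log u) := by positivity
    rcases le_or_gt 1 v with hv1 | hv1
    · have h2 := (abs_le.mp (h v hv1)).1
      rw [hlv] at h2
      have h3 : 2 * (u - v) * Real.log u ≤ 2 * (u * δ) * Real.log u := by gcongr
      have h4 : C * v ≤ C * u := by gcongr
      have h5 : v * δ ≤ u * 1 := by gcongr
      nlinarith
    · have h0 : ⌊v⌋₊ = 0 := Nat.floor_eq_zero.mpr hv1
      rw [h0] at hsplit
      simp only [zero_lt_one, Icc_eq_empty_of_lt, sum_empty, add_zero] at hsplit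
      have h6 : Real.log u ≤ 1 := by
        have := Real.log_nonpos hv0.le hv1.le
        linarith
      rw [hsplit]
      nlinarith
  calc ∑ n ∈ Icc 1 ⌊u⌋₊ with v < (n : ℕ), selbergLambda n / n
      ≤ ∑ n ∈ Icc 1 ⌊u⌋₊ with v < (n : ℕ), selbergLambda n * (Real.exp 1 / u) := by
        refine sum_le_sum fun n hn => ?_
        have hn := (mem_filter.mp hn).2
        rw [div_eq_mul_inv]
        refine mul_le_mul_of_nonneg_left ?_ (selbergLambda_nonneg n)
        have : (v : ℝ)⁻¹ = Real.exp δ / u := by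
          rw [hv, mul_inv, ← Real.exp_neg, neg_neg]; field_simp
        calc (n : ℝ)⁻¹ ≤ v⁻¹ := by gcongr
          _ = Real.exp δ / u := this
          _ ≤ _ := by gcongr
    _ ≤ (u * ((2 + 2 * C) * (1 + δ * Real.log u))) * (Real.exp 1 / u) := by
        rw [← sum_mul]
        gcongr
    _ = _ := by field_simp

end

section

open Finset ArithmeticFunction

theorem sum_vonMangoldt_mul_meanValue {f : ℕ → ℝ} (hf : IsComplMult f) {t : ℝ} (ht : 0 < t) :
    ∑ n ∈ Icc 1 ⌊t⌋₊, Λ n * f n / n * meanValue f (t / n) =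
      (∑ n ∈ Icc 1 ⌊t⌋₊, f n * Real.log n) / t := by
  have h := sum_Icc_sum_divisorsAntidiagonal t fun d m => Λ d * f d * f m
  have h1 : ∀ n ∈ Icc 1 ⌊t⌋₊, ∑ p ∈ n.divisorsAntidiagonal, Λ p.1 * f p.1 * f p.2 =
      f n * Real.log n := by
    intro n _
    have : ∀ p ∈ n.divisorsAntidiagonal, Λ p.1 * f p.1 * f p.2 = f n * Λ p.1 := by
      intro p hp
      obtain ⟨h2, h3⟩ := Nat.mem_divisorsAntidiagonal.mp hp
      have hp0 : p.1 * p.2 ≠ 0 := by rwa [h2]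
      rw [← h2, hf.2 p.1 p.2 (Nat.pos_of_ne_zero (left_ne_zero_of_mul hp0))
        (Nat.pos_of_ne_zero (right_ne_zero_of_mul hp0))]
      ring
    rw [sum_congr rfl this, ← mul_sum, Nat.sum_divisorsAntidiagonal (fun d _ => Λ d),
      vonMangoldt_sum]
  rw [sum_congr rfl h1] at h
  rw [h, sum_div]
  refine sum_congr rfl fun n hn => ?_
  have hn0 : (n : ℝ) ≠ 0 := by linarith [(floor_pos_of_mem hn).2.1]
  rw [meanValue, partialSum, ← mul_sum]
  field_simp

/-- The mean values of a completely multiplicative function satisfy an approximate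
convolution equation. -/
theorem abs_meanValue_mul_log_sub_le {f : ℕ → ℝ} (hf : IsComplMult f)
    (hb : ∀ n : ℕ, 0 < n → |f n| ≤ 1) {t : ℝ} (ht : 1 ≤ t) :
    |meanValue f t * Real.log t -
      ∑ n ∈ Icc 1 ⌊t⌋₊, Λ n * f n / n * meanValue f (t / n)| ≤ 1 := by
  have ht0 : 0 < t := by linarith
  have h : meanValue f t * Real.log t - (∑ n ∈ Icc 1 ⌊t⌋₊, f n * Real.log n) / t =
      (∑ n ∈ Icc 1 ⌊t⌋₊, f n * Real.log (t / n)) / t := by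
    rw [meanValue, partialSum, div_mul_eq_mul_div, ← sub_div, sum_mul, ← sum_sub_distrib]
    congr 1
    refine sum_congr rfl fun n hn => ?_
    rw [Real.log_div ht0.ne' (by linarith [(floor_pos_of_mem hn).2.1])]
    ring
  rw [sum_vonMangoldt_mul_meanValue hf ht0, h, abs_div, abs_of_pos ht0, div_le_one ht0]
  refine (abs_sum_le_sum_abs _ _).trans ((sum_le_sum fun n hn => ?_).trans (sum_log_div_le ht))
  obtain ⟨h1, -, -, h2⟩ := floor_pos_of_mem hn
  rw [abs_mul, abs_of_nonneg (Real.log_nonneg h2)]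
  exact mul_le_of_le_one_left (Real.log_nonneg h2) (hb n h1)

theorem sum_Icc_mul_eq_of_eq_zero {f F : ℕ → ℝ} {s t : ℝ} (hst : s ≤ t)
    (hF : ∀ n : ℕ, s < n → F n = 0) :
    ∑ n ∈ Icc 1 ⌊t⌋₊, f n * F n = ∑ n ∈ Icc 1 ⌊s⌋₊, f n * F n := by
  refine (sum_subset (Icc_subset_Icc_right (Nat.floor_mono hst)) fun n hn hn' => ?_).symm
  rw [mem_Icc] at hn hn'
  rw [hF n, mul_zero]
  by_contra! h
  exact hn' ⟨hn.1, Nat.le_floor h⟩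

theorem abs_meanDiff_mul_log_sub_le {f : ℕ → ℝ} (hf : IsComplMult f)
    (hb : ∀ n : ℕ, 0 < n → |f n| ≤ 1) {z t : ℝ} (hz : 1 ≤ z) (ht : 1 ≤ t) :
    |meanDiff f z t * Real.log t -
      ∑ n ∈ Icc 1 ⌊t⌋₊, Λ n * f n / n * meanDiff f z (t / n)| ≤ 2 + Real.log z := by
  have ht0 : 0 < t := by linarith
  have hz0 : 0 < z := by linarith
  have hℓ := Real.log_nonneg hz
  have h1 := abs_le.mp (abs_meanValue_mul_log_sub_le hf hb ht)
  have htz : t / z ≤ t := div_le_self ht0.le hz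
  have h2 : |meanValue f (t / z) * Real.log t -
      ∑ n ∈ Icc 1 ⌊t⌋₊, Λ n * f n / n * meanValue f (t / n / z)| ≤ 1 + Real.log z := by
    rw [sum_Icc_mul_eq_of_eq_zero htz]
    · rcases le_or_gt 1 (t / z) with h | h
      · have h3 := abs_le.mp (abs_meanValue_mul_log_sub_le hf hb h)
        have h4 : |meanValue f (t / z) * Real.log z| ≤ Real.log z := by
          rw [abs_mul, abs_of_nonneg hℓ]
          exact mul_le_of_le_one_left hℓ (abs_meanValue_le hb _)
        have h4 := abs_le.mp h4
        rw [Real.log_div ht0.ne' hz0.ne'] at h3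
        simp only [div_right_comm t z] at h3
        rw [abs_le]
        constructor <;> linarith
      · rw [meanValue_of_lt_one h, Nat.floor_eq_zero.mpr h]
        simpa using by linarith
    · intro n hn
      refine meanValue_of_lt_one ?_
      rw [div_right_comm, div_lt_one (lt_of_le_of_lt (by positivity) hn)]
      exact hn
  have h2 := abs_le.mp h2
  simp only [meanDiff, mul_sub, sum_sub_distrib, sub_mul]
  rw [abs_le]
  constructor <;> linarith

end

section

open MeasureTheory ArithmeticFunction

theorem abs_meanDiff_exp_mul_le {f : ℕ → ℝ} (hf : IsComplMult f)
    (hb : ∀ n : ℕ, 0 < n → |f n| ≤ 1) {z X v : ℝ} (hz : 1 ≤ z) (hX : 0 < X) (hv : 0 ≤ v)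
    (hvX : v ≤ X) :
    |meanDiff f z (Real.exp v)| * v ≤
      Real.exp 1 * |∑ n ∈ Finset.Icc 1 ⌊Real.exp X⌋₊,
        (Λ n * f n / n * Real.exp (-(1 / X) * Real.log n)) *
          dampedDiff f z (1 / X) (v - Real.log n)| + (2 + Real.log z) := by
  have h1 := abs_meanDiff_mul_log_sub_le hf hb hz (Real.one_le_exp hv)
  rw [Real.log_exp] at h1
  have h2 : ∑ n ∈ Finset.Icc 1 ⌊Real.exp X⌋₊,
        (Λ n * f n / n * Real.exp (-(1 / X) * Real.log n)) *
          dampedDiff f z (1 / X) (v - Real.log n) = Real.exp (-(1 / X) * v) *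
      ∑ n ∈ Finset.Icc 1 ⌊Real.exp v⌋₊, Λ n * f n / n * meanDiff f z (Real.exp v / n) := by
    rw [← sum_Icc_mul_eq_of_eq_zero (Real.exp_le_exp.mpr hvX), Finset.mul_sum]
    · refine Finset.sum_congr rfl fun n hn => ?_
      have hn0 : (0 : ℝ) < n := by linarith [(floor_pos_of_mem hn).2.1]
      rw [dampedDiff, Real.exp_sub, Real.exp_log hn0, mul_sub, Real.exp_sub, neg_mul (1 / X),
        neg_mul (1 / X), Real.exp_neg (1 / X * Real.log n)]
      have := (Real.exp_pos (1 / X * Real.log n)).ne'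
      have := (Real.exp_pos (-(1 / X * Real.log n))).ne'
      rw [Real.exp_neg] at this
      rw [Real.exp_neg]
      field_simp
    · intro n hn
      refine meanDiff_of_lt_one hz ?_
      rwa [div_lt_one ((Real.exp_pos v).trans hn)]
  rw [h2, abs_mul, Real.abs_exp, ← mul_assoc, ← Real.exp_add]
  set S := ∑ n ∈ Finset.Icc 1 ⌊Real.exp v⌋₊, Λ n * f n / n * meanDiff f z (Real.exp v / n)
  have h3 : 1 ≤ Real.exp (1 + -(1 / X) * v) := by
    refine Real.one_le_exp ?_
    have : v / X ≤ 1 := by rwa [div_le_one hX]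
    have : 1 / X * v = v / X := by ring
    linarith
  have h4 : |S| ≤ Real.exp (1 + -(1 / X) * v) * |S| := le_mul_of_one_le_left (abs_nonneg _) h3
  have h5 := abs_sub_abs_le_abs_sub (meanDiff f z (Real.exp v) * v) S
  rw [abs_mul, abs_of_nonneg hv] at h5
  linarith

theorem intervalIntegrable_abs_meanDiff_exp {f : ℕ → ℝ} (hb : ∀ n : ℕ, 0 < n → |f n| ≤ 1)
    (z a b : ℝ) : IntervalIntegrable (fun v => |meanDiff f z (Real.exp v)|) volume a b := by
  have hm : Measurable fun v => |meanDiff f z (Real.exp v)| := by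
    have := (measurable_meanDiff (f := f) (z := z)).comp Real.measurable_exp
    simp only [Function.comp_def] at this
    fun_prop
  refine (intervalIntegrable_const (c := (2 : ℝ))).mono_fun hm.aestronglyMeasurable ?_
  refine Filter.Eventually.of_forall fun v => ?_
  simpa using abs_meanDiff_le hb z (Real.exp v)

theorem exists_integral_half_abs_meanDiff_le :
    ∃ C : ℝ, 0 < C ∧ ∀ f : ℕ → ℝ, IsComplMult f → (∀ n : ℕ, 0 < n → -1 ≤ f n ∧ f n ≤ 1) →
      ∀ z X : ℝ, 1 ≤ z → 1 ≤ X → ∫ v in (X / 2)..X, |meanDiff f z (Real.exp v)| ≤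
        C * (1 + Real.log z) * X ^ (17 / 24 : ℝ) := by
  obtain ⟨C, hC, h⟩ := exists_integral_norm_sq_sum_dampedDiff_le
  have hl4 : 0 ≤ Real.log 4 := Real.log_nonneg (by norm_num)
  set A := Real.log 4 + 4 with hA
  refine ⟨2 * Real.exp 1 * (C * Real.sqrt (2 * A * (1 + A))) + 2, by positivity, ?_⟩
  intro f hf hb z X hz hX
  have hb' : ∀ n : ℕ, 0 < n → |f n| ≤ 1 := fun n hn => abs_le.mpr (hb n hn)
  have hX0 : 0 < X := by linarith
  have hℓ := Real.log_nonneg hz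
  have hpow : 1 ≤ X ^ (17 / 24 : ℝ) := Real.one_le_rpow hX (by norm_num)
  set s := Finset.Icc 1 ⌊Real.exp X⌋₊ with hs
  set a : ℕ → ℝ := fun n => Λ n * f n / n * Real.exp (-(1 / X) * Real.log n) with ha
  set g : ℝ → ℝ := fun v => ∑ n ∈ s, a n * dampedDiff f z (1 / X) (v - Real.log n) with hg
  set B := C * Real.sqrt (2 * A * (1 + A)) * (1 + Real.log z) * X ^ (17 / 24 : ℝ) with hB
  have hB0 : 0 < B := by positivity
  have hgL : MemLp g 2 := by
    have := (memLp_sum_translates (dampedDiff_memLp hb' (σ := 1 / X) (by positivity) hz).2 s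
      (fun n => (a n : ℂ)) (fun n => Real.log n)).re
    simpa [hg] using this
  have haΛ : ∀ n ∈ s, |a n| ≤ Λ n / n := by
    intro n hn
    obtain ⟨h1, h2, -, -⟩ := floor_pos_of_mem hn
    rw [ha]
    simp only [abs_mul, abs_div, Real.abs_exp, Nat.abs_cast, abs_of_nonneg vonMangoldt_nonneg]
    have h3 : Real.exp (-(1 / X) * Real.log n) ≤ 1 := by
      rw [Real.exp_le_one_iff, neg_mul, neg_nonpos]
      exact mul_nonneg (by positivity) (Real.log_natCast_nonneg n)
    calc Λ n * |f n| / n * Real.exp (-(1 / X) * Real.log n) ≤ Λ n * 1 / n * 1 := by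
          have := vonMangoldt_nonneg (n := n)
          gcongr
          exact hb' n h1
      _ = Λ n / n := by ring
  have hint : ∫ v, g v ^ 2 ≤ B ^ 2 * X := by
    refine (h f hf hb z X hz hX s a fun n => Real.log n).trans ?_
    have h1 := sum_sum_vonMangoldt_mul_exp_le (Real.one_le_exp hX0.le)
    rw [Real.log_exp, ← hA] at h1
    have h2 : ∑ n ∈ s, ∑ m ∈ s, |a n| * |a m| * Real.exp (-|Real.log n - Real.log m|) ≤
        2 * A * (1 + A) * X := by
      calc _ ≤ _ := Finset.sum_le_sum fun n hn => Finset.sum_le_sum fun m hm =>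
            mul_le_mul_of_nonneg_right (mul_le_mul (haΛ n hn) (haΛ m hm) (abs_nonneg _)
              ((abs_nonneg _).trans (haΛ n hn))) (Real.exp_pos _).le
        _ ≤ _ := h1
        _ ≤ 2 * A * (1 + A) * X := by
          have : X + A ≤ (1 + A) * X := by nlinarith
          calc _ ≤ 2 * A * ((1 + A) * X) := by gcongr
            _ = _ := by ring
    have h3 : Real.sqrt (2 * A * (1 + A)) ^ 2 = 2 * A * (1 + A) := Real.sq_sqrt (by positivity)
    calc _ ≤ (C * (1 + Real.log z) * X ^ (17 / 24 : ℝ)) ^ 2 * (2 * A * (1 + A) * X) := by gcongr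
      _ = B ^ 2 * X := by
        rw [hB]
        linear_combination -(C * (1 + Real.log z) * X ^ (17 / 24 : ℝ)) ^ 2 * X * h3
  have hpt : ∀ v ∈ Set.Icc (X / 2) X, |meanDiff f z (Real.exp v)| ≤
      2 / X * (Real.exp 1 * (g v ^ 2 / (2 * B) + B / 2) + (2 + Real.log z)) := by
    intro v hv
    have h1 := abs_meanDiff_exp_mul_le hf hb' hz hX0 (by linarith [hv.1]) hv.2
    have h2 : |g v| ≤ g v ^ 2 / (2 * B) + B / 2 := by
      rw [← sub_nonneg]
      have : g v ^ 2 / (2 * B) + B / 2 - |g v| = (|g v| - B) ^ 2 / (2 * B) := by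
        rw [← sq_abs (g v)]
        field_simp
        ring
      rw [this]; positivity
    have h3 : |meanDiff f z (Real.exp v)| * (X / 2) ≤ |meanDiff f z (Real.exp v)| * v := by
      gcongr; exact hv.1
    have h4 : Real.exp 1 * |g v| ≤ Real.exp 1 * (g v ^ 2 / (2 * B) + B / 2) := by gcongr
    have h5 : |meanDiff f z (Real.exp v)| * (X / 2) ≤
      Real.exp 1 * (g v ^ 2 / (2 * B) + B / 2) + (2 + Real.log z) := by
      refine h3.trans (h1.trans ?_)
      simp only [hg, ha] at h4
      linarith
    rw [div_mul_eq_mul_div, le_div_iff₀ hX0]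
    linarith
  have hsq : ∫ v in (X / 2)..X, g v ^ 2 ≤ B ^ 2 * X := by
    rw [intervalIntegral.integral_of_le (by linarith)]
    exact (setIntegral_le_integral hgL.integrable_sq
      (Filter.Eventually.of_forall fun v => sq_nonneg _)).trans hint
  have hgsq' : IntervalIntegrable (fun v => g v ^ 2) volume (X / 2) X :=
    hgL.integrable_sq.intervalIntegrable
  have hmono := intervalIntegral.integral_mono_on (by linarith)
    (intervalIntegrable_abs_meanDiff_exp hb' z (X / 2) X)
    (((((hgsq'.div_const (2 * B)).add intervalIntegrable_const).const_mul
      (Real.exp 1)).add intervalIntegrable_const).const_mul (2 / X)) hpt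
  refine hmono.trans ?_
  rw [intervalIntegral.integral_const_mul, intervalIntegral.integral_add
    (((hgsq'.div_const (2 * B)).add intervalIntegrable_const).const_mul _)
    intervalIntegrable_const, intervalIntegral.integral_const_mul,
    intervalIntegral.integral_add (hgsq'.div_const (2 * B)) intervalIntegrable_const,
    intervalIntegral.integral_div]
  simp only [intervalIntegral.integral_const, smul_eq_mul]
  calc _ ≤ 2 / X * (Real.exp 1 * (B ^ 2 * X / (2 * B) + (X - X / 2) * (B / 2)) +
        (X - X / 2) * (2 + Real.log z)) := by gcongr
    _ = 3 / 2 * (Real.exp 1 * B) + (2 + Real.log z) := by field_simp; ring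
    _ ≤ 2 * (Real.exp 1 * B) + 2 * (1 + Real.log z) * X ^ (17 / 24 : ℝ) := by
      have h1 : 0 < Real.exp 1 * B := by positivity
      have h2 : 2 * (1 + Real.log z) * 1 ≤ 2 * (1 + Real.log z) * X ^ (17 / 24 : ℝ) := by gcongr
      linarith
    _ = _ := by rw [hB]; ring

/-- The mean over `[0, X]` of the variation of the mean values, on a logarithmic scale. -/
theorem exists_integral_abs_meanDiff_le :
    ∃ C : ℝ, 0 < C ∧ ∀ f : ℕ → ℝ, IsComplMult f → (∀ n : ℕ, 0 < n → -1 ≤ f n ∧ f n ≤ 1) →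
      ∀ z X : ℝ, 1 ≤ z → 1 ≤ X → ∫ v in (0 : ℝ)..X, |meanDiff f z (Real.exp v)| ≤
        C * (1 + Real.log z) * X ^ (17 / 24 : ℝ) := by
  obtain ⟨C, hC, h⟩ := exists_integral_half_abs_meanDiff_le
  refine ⟨4 * C + 2, by positivity, fun f hf hb z X hz hX => ?_⟩
  have hb' : ∀ n : ℕ, 0 < n → |f n| ≤ 1 := fun n hn => abs_le.mpr (hb n hn)
  have hℓ := Real.log_nonneg hz
  obtain ⟨k, hk⟩ := pow_unbounded_of_one_lt X (one_lt_two (α := ℝ))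
  induction k generalizing X with
  | zero => simp at hk; linarith
  | succ k ih =>
    have hsplit := intervalIntegral.integral_add_adjacent_intervals
      (intervalIntegrable_abs_meanDiff_exp hb' z 0 (X / 2))
      (intervalIntegrable_abs_meanDiff_exp hb' z (X / 2) X)
    rw [← hsplit]
    have h1 := h f hf hb z X hz hX
    have hpow : 1 ≤ X ^ (17 / 24 : ℝ) := Real.one_le_rpow hX (by norm_num)
    have hCp : 0 ≤ C * (1 + Real.log z) * X ^ (17 / 24 : ℝ) := by positivity
    rcases le_or_gt 1 (X / 2) with h2 | h2
    · have h3 := ih (X / 2) h2 (by rw [pow_succ] at hk; linarith)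
      have h4 : (X / 2) ^ (17 / 24 : ℝ) ≤ 3 / 4 * X ^ (17 / 24 : ℝ) := by
        rw [Real.div_rpow (by linarith) (by norm_num), div_le_iff₀ (by positivity)]
        have h5 : (4 / 3 : ℝ) ≤ 2 ^ (17 / 24 : ℝ) := by
          calc (4 / 3 : ℝ) ≤ Real.sqrt 2 := Real.le_sqrt_of_sq_le (by norm_num)
            _ = 2 ^ (1 / 2 : ℝ) := Real.sqrt_eq_rpow 2
            _ ≤ _ := Real.rpow_le_rpow_of_exponent_le (by norm_num) (by norm_num)
        nlinarith
      calc _ ≤ (4 * C + 2) * (1 + Real.log z) * (3 / 4 * X ^ (17 / 24 : ℝ)) +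
            C * (1 + Real.log z) * X ^ (17 / 24 : ℝ) := by
            refine add_le_add (h3.trans ?_) h1
            gcongr
        _ ≤ _ := by
          have : 0 ≤ (1 + Real.log z) * X ^ (17 / 24 : ℝ) := by positivity
          linarith
    · have h3 : ∫ v in (0 : ℝ)..(X / 2), |meanDiff f z (Real.exp v)| ≤
          ∫ v in (0 : ℝ)..(X / 2), (2 : ℝ) :=
        intervalIntegral.integral_mono_on (by linarith)
          (intervalIntegrable_abs_meanDiff_exp hb' z 0 (X / 2)) intervalIntegrable_const
          fun v _ => abs_meanDiff_le hb' z _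
      simp only [intervalIntegral.integral_const, smul_eq_mul] at h3
      have h4 : 2 * 1 * 1 ≤ 2 * (1 + Real.log z) * X ^ (17 / 24 : ℝ) := by
        gcongr; linarith
      linarith

end

section

open Finset ArithmeticFunction

theorem sum_selbergLambda_div_mul (G : ℝ → ℝ) (x : ℝ) :
    ∑ n ∈ Icc 1 ⌊x⌋₊, selbergLambda n / n * G (x / n) =
      ∑ n ∈ Icc 1 ⌊x⌋₊, Λ n / n * (Real.log n * G (x / n) +
        ∑ m ∈ Icc 1 ⌊x / n⌋₊, Λ m / m * G (x / n / m)) := by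
  have h := sum_Icc_sum_divisorsAntidiagonal x
    fun d m => Λ d / d * (Λ m / m * G (x / d / m))
  simp only [← mul_sum] at h
  simp only [mul_add, sum_add_distrib]
  rw [← h, ← sum_add_distrib]
  refine sum_congr rfl fun n _ => ?_
  have : ∀ p ∈ n.divisorsAntidiagonal, Λ p.1 / p.1 * (Λ p.2 / p.2 * G (x / p.1 / p.2)) =
      Λ p.1 * Λ p.2 * (1 / n * G (x / n)) := by
    intro p hp
    rw [← (Nat.mem_divisorsAntidiagonal.mp hp).1, div_div x]
    push_cast
    ring
  rw [sum_congr rfl this, ← sum_mul, selbergLambda]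
  ring

theorem abs_meanDiff_mul_log_sq_le {f : ℕ → ℝ} (hf : IsComplMult f)
    (hb : ∀ n : ℕ, 0 < n → |f n| ≤ 1) {z x : ℝ} (hz : 1 ≤ z) (hx : 1 ≤ x) :
    |meanDiff f z x| * Real.log x ^ 2 ≤
      ∑ n ∈ Icc 1 ⌊x⌋₊, selbergLambda n / n * |meanDiff f z (x / n)| +
        (2 + Real.log z) * (2 * Real.log x + (Real.log 4 + 4)) := by
  have hfirst : ∀ t : ℝ, 1 ≤ t → |meanDiff f z t| * Real.log t ≤
      ∑ n ∈ Icc 1 ⌊t⌋₊, Λ n / n * |meanDiff f z (t / n)| + (2 + Real.log z) := by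
    intro t ht
    have h1 := abs_meanDiff_mul_log_sub_le hf hb hz ht
    have h2 := abs_sub_abs_le_abs_sub (meanDiff f z t * Real.log t)
      (∑ n ∈ Icc 1 ⌊t⌋₊, Λ n * f n / n * meanDiff f z (t / n))
    rw [abs_mul, abs_of_nonneg (Real.log_nonneg ht)] at h2
    have h3 : |∑ n ∈ Icc 1 ⌊t⌋₊, Λ n * f n / n * meanDiff f z (t / n)| ≤
        ∑ n ∈ Icc 1 ⌊t⌋₊, Λ n / n * |meanDiff f z (t / n)| := by
      refine (abs_sum_le_sum_abs _ _).trans (sum_le_sum fun n hn => ?_)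
      rw [abs_mul, abs_div, abs_mul, Nat.abs_cast, abs_of_nonneg vonMangoldt_nonneg]
      gcongr
      exact mul_le_of_le_one_right vonMangoldt_nonneg (hb n (floor_pos_of_mem hn).1)
    linarith
  have hx0 : 0 < x := by linarith
  have hL := Real.log_nonneg hx
  have hℓ := Real.log_nonneg hz
  have h1 := mul_le_mul_of_nonneg_right (hfirst x hx) hL
  have h2 : (∑ n ∈ Icc 1 ⌊x⌋₊, Λ n / n * |meanDiff f z (x / n)|) * Real.log x ≤
      ∑ n ∈ Icc 1 ⌊x⌋₊, selbergLambda n / n * |meanDiff f z (x / n)| +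
        (2 + Real.log z) * ∑ n ∈ Icc 1 ⌊x⌋₊, Λ n / n := by
    rw [sum_selbergLambda_div_mul (fun t => |meanDiff f z t|), sum_mul, mul_sum,
      ← sum_add_distrib]
    refine sum_le_sum fun n hn => ?_
    obtain ⟨-, h3, -, h4⟩ := floor_pos_of_mem hn
    have h5 := hfirst (x / n) h4
    rw [Real.log_div hx0.ne' (by linarith)] at h5
    have h6 : 0 ≤ Λ n / n := div_nonneg vonMangoldt_nonneg (by linarith)
    nlinarith [mul_le_mul_of_nonneg_left h5 h6]
  have h3 := mul_le_mul_of_nonneg_left (sum_vonMangoldt_div_le hx)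
    (show 0 ≤ 2 + Real.log z by linarith)
  nlinarith

theorem exists_sum_selbergLambda_div_le_sq : ∃ C : ℝ, 0 < C ∧ ∀ x : ℝ, 1 ≤ x →
    ∑ n ∈ Icc 1 ⌊x⌋₊, selbergLambda n / n ≤ C * (1 + Real.log x) ^ 2 := by
  have hl4 : 0 ≤ Real.log 4 := Real.log_nonneg (by norm_num)
  set A := Real.log 4 + 4 with hA
  refine ⟨2 * A * A, by positivity, fun x hx => ?_⟩
  have hL := Real.log_nonneg hx
  have hx0 : 0 < x := by linarith
  have hA1 : 1 ≤ A := by linarith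
  have h := sum_selbergLambda_div_mul (fun _ => 1) x
  simp only [mul_one] at h
  rw [h]
  have hsum := sum_vonMangoldt_div_le hx
  rw [← hA] at hsum
  have hle : Real.log x + A ≤ A * (1 + Real.log x) := by nlinarith
  calc _ ≤ ∑ n ∈ Icc 1 ⌊x⌋₊, Λ n / n * (2 * (A * (1 + Real.log x))) := by
        refine sum_le_sum fun n hn => mul_le_mul_of_nonneg_left ?_
          (div_nonneg vonMangoldt_nonneg (by positivity))
        obtain ⟨-, h1, h2, h3⟩ := floor_pos_of_mem hn
        have h4 := sum_vonMangoldt_div_le h3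
        rw [← hA, Real.log_div hx0.ne' (by linarith)] at h4
        have h5 := Real.log_le_log (by linarith) h2
        have h6 := Real.log_nonneg h1
        nlinarith
    _ ≤ (A * (1 + Real.log x)) * (2 * (A * (1 + Real.log x))) := by
        rw [← sum_mul]
        gcongr
        linarith
    _ = _ := by ring

theorem partialSum_sub_partialSum (f : ℕ → ℝ) {s t : ℝ} (hst : s ≤ t) :
    partialSum f t - partialSum f s = ∑ n ∈ Ioc ⌊s⌋₊ ⌊t⌋₊, f n := by
  have h := Nat.floor_mono hst
  have hd : Icc 1 ⌊t⌋₊ \ Icc 1 ⌊s⌋₊ = Ioc ⌊s⌋₊ ⌊t⌋₊ := by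
    ext n
    simp only [mem_sdiff, mem_Icc, mem_Ioc]
    omega
  rw [partialSum, partialSum, ← sum_sdiff (Icc_subset_Icc_right (a := 1) h),
    add_sub_cancel_right, hd]

theorem abs_partialSum_sub_le {f : ℕ → ℝ} (hb : ∀ n : ℕ, 0 < n → |f n| ≤ 1) {s t : ℝ}
    (hs : 0 ≤ s) (hst : s ≤ t) : |partialSum f t - partialSum f s| ≤ t - s + 1 := by
  rw [partialSum_sub_partialSum f hst]
  calc _ ≤ ∑ n ∈ Ioc ⌊s⌋₊ ⌊t⌋₊, (1 : ℝ) :=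
        (abs_sum_le_sum_abs _ _).trans (sum_le_sum fun n hn => hb n (by
          have := (mem_Ioc.mp hn).1; omega))
    _ = (⌊t⌋₊ : ℝ) - ⌊s⌋₊ := by simp [Nat.cast_sub (Nat.floor_mono hst)]
    _ ≤ _ := by
        have := Nat.floor_le (hs.trans hst)
        have := Nat.lt_floor_add_one s
        linarith

theorem abs_meanValue_sub_le {f : ℕ → ℝ} (hb : ∀ n : ℕ, 0 < n → |f n| ≤ 1) {t v : ℝ}
    (ht : 0 < t) (hv : 0 ≤ v) :
    |meanValue f t - meanValue f (t * Real.exp (-v))| ≤ 2 * v + 1 / t := by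
  set s := t * Real.exp (-v) with hs
  have hs0 : 0 < s := by positivity
  have hst : s ≤ t := mul_le_of_le_one_right ht.le (Real.exp_le_one_iff.mpr (by linarith))
  have h1 := abs_partialSum_sub_le hb hs0.le hst
  have h2 := abs_meanValue_le hb s
  have h3 : t - s ≤ t * v := by
    have := Real.add_one_le_exp (-v)
    rw [hs]; nlinarith
  have h4 : meanValue f t - meanValue f s =
      (partialSum f t - partialSum f s) / t - meanValue f s * ((t - s) / t) := by
    rw [meanValue, meanValue]
    field_simp
    ring
  have h5 : 0 ≤ (t - s) / t := div_nonneg (by linarith) ht.le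
  have h6 : (t - s) / t ≤ v := by rw [div_le_iff₀ ht]; linarith
  calc _ = |(partialSum f t - partialSum f s) / t - meanValue f s * ((t - s) / t)| := by rw [h4]
    _ ≤ |(partialSum f t - partialSum f s) / t| + |meanValue f s * ((t - s) / t)| := abs_sub _ _
    _ ≤ (t - s + 1) / t + 1 * ((t - s) / t) := by
        rw [abs_div, abs_of_pos ht, abs_mul, abs_of_nonneg h5]
        gcongr
    _ = 2 * ((t - s) / t) + 1 / t := by ring
    _ ≤ _ := by linarith

theorem abs_meanDiff_le_add {f : ℕ → ℝ} (hb : ∀ n : ℕ, 0 < n → |f n| ≤ 1) {z t v : ℝ}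
    (hz : 0 < z) (ht : 0 < t) (hv : 0 ≤ v) :
    |meanDiff f z t| ≤ |meanDiff f z (t * Real.exp (-v))| + (4 * v + (1 + z) / t) := by
  have h1 := abs_meanValue_sub_le hb ht hv
  have h2 := abs_meanValue_sub_le hb (div_pos ht hz) hv
  have h3 : meanDiff f z t = meanDiff f z (t * Real.exp (-v)) +
      ((meanValue f t - meanValue f (t * Real.exp (-v))) -
        (meanValue f (t / z) - meanValue f (t / z * Real.exp (-v)))) := by
    rw [meanDiff, meanDiff, div_mul_eq_mul_div]
    ring
  rw [h3]
  refine (abs_add_le _ _).trans (add_le_add le_rfl ((abs_sub _ _).trans ?_))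
  have h4 : 1 / (t / z) = z / t := by field_simp
  rw [add_div]
  linarith

end

section

open MeasureTheory

/-- Short-interval averaging of a sum weighted by Selberg's function. -/
theorem exists_sum_selbergLambda_mul_integral_le : ∃ C : ℝ, 0 < C ∧
    ∀ (G : ℝ → ℝ) (L : ℝ), 1 ≤ L → Integrable G → (∀ w, 0 ≤ G w) → (∀ w, L < w → G w = 0) →
      ∑ n ∈ Finset.Icc 1 ⌊Real.exp L⌋₊, selbergLambda n / n *
          ∫ w in Set.Ico (Real.log n) (Real.log n + 1 / L), G w ≤
        C * ∫ w in Set.Icc 0 L, G w := by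
  obtain ⟨C, hC, h⟩ := exists_sum_selbergLambda_div_le
  refine ⟨2 * C, by positivity, fun G L hL hG hG0 hGL => ?_⟩
  have hL0 : 0 < L := by linarith
  have hδ1 : 1 / L ≤ 1 := by rw [div_le_one hL0]; exact hL
  set s := Finset.Icc 1 ⌊Real.exp L⌋₊
  set b : ℕ → ℝ := fun n => selbergLambda n / n
  have hb0 : ∀ n, 0 ≤ b n := fun n => div_nonneg (selbergLambda_nonneg n) (by positivity)
  have hi : ∀ n ∈ s, Integrable fun w =>
      b n * (Set.Ico (Real.log n) (Real.log n + 1 / L)).indicator G w :=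
    fun n _ => (hG.indicator measurableSet_Ico).const_mul _
  calc ∑ n ∈ s, b n * ∫ w in Set.Ico (Real.log n) (Real.log n + 1 / L), G w
      = ∫ w, ∑ n ∈ s, b n * (Set.Ico (Real.log n) (Real.log n + 1 / L)).indicator G w := by
        rw [integral_finsetSum _ hi]
        refine Finset.sum_congr rfl fun n _ => ?_
        rw [integral_const_mul, integral_indicator measurableSet_Ico]
    _ ≤ ∫ w, 2 * C * (Set.Icc 0 L).indicator G w := by
        refine integral_mono (integrable_finsetSum _ hi)
          ((hG.indicator measurableSet_Icc).const_mul _) fun w => ?_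
        have heq : ∀ n ∈ s, b n * (Set.Ico (Real.log n) (Real.log n + 1 / L)).indicator G w =
            (if w ∈ Set.Ico (Real.log n) (Real.log n + 1 / L) then b n else 0) * G w := by
          intro n _
          rw [Set.indicator_apply]
          split_ifs <;> simp
        simp only
        rw [Finset.sum_congr rfl heq, ← Finset.sum_mul, ← Finset.sum_filter]
        rcases lt_or_ge w 0 with hw | hw
        · rw [Finset.filter_false_of_mem, Set.indicator_of_notMem (by simp [hw])]
          · simp
          · intro n _ hn
            have := Real.log_natCast_nonneg n
            linarith [hn.1]
        rcases lt_or_ge L w with hw' | hw'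
        · rw [hGL w hw', Set.indicator_of_notMem (by simp [hw'])]
          simp
        rw [Set.indicator_of_mem (Set.mem_Icc.mpr ⟨hw, hw'⟩)]
        refine mul_le_mul_of_nonneg_right ?_ (hG0 w)
        have h1 := h (Real.exp w) (1 / L) (Real.one_le_exp hw) (by positivity) hδ1
        rw [Real.log_exp] at h1
        refine (Finset.sum_le_sum_of_subset_of_nonneg ?_ fun n _ _ => hb0 n).trans (h1.trans ?_)
        · intro n hn
          obtain ⟨hn, hn'⟩ := Finset.mem_filter.mp hn
          have hn1 := (Finset.mem_Icc.mp hn).1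
          have hn0 : (0 : ℝ) < n := by exact_mod_cast hn1
          refine Finset.mem_filter.mpr ⟨Finset.mem_Icc.mpr ⟨hn1, Nat.le_floor ?_⟩, ?_⟩
          · exact (Real.log_le_iff_le_exp hn0).mp hn'.1
          · rw [← Real.exp_add]
            refine (Real.lt_log_iff_exp_lt hn0).mp ?_
            linarith [hn'.2]
        · have : 1 / L * w ≤ 1 := by rw [one_div_mul_eq_div, div_le_one hL0]; exact hw'
          nlinarith
    _ = 2 * C * ∫ w in Set.Icc 0 L, G w := by
        rw [integral_const_mul, integral_indicator measurableSet_Icc]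

theorem exists_sum_selbergLambda_mul_abs_meanDiff_le : ∃ C : ℝ, 0 < C ∧
    ∀ f : ℕ → ℝ, (∀ n : ℕ, 0 < n → |f n| ≤ 1) → ∀ z L : ℝ, 1 ≤ z → 1 ≤ L →
      ∑ n ∈ Finset.Icc 1 ⌊Real.exp L⌋₊,
          selbergLambda n / n * |meanDiff f z (Real.exp L / n)| ≤
        C * (L * (∫ v in (0 : ℝ)..L, |meanDiff f z (Real.exp v)|) + L * z) := by
  obtain ⟨C₁, hC₁, h₁⟩ := exists_sum_selbergLambda_mul_integral_le
  obtain ⟨C₂, hC₂, h₂⟩ := exists_sum_selbergLambda_div_le_sq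
  obtain ⟨C₃, hC₃, h₃⟩ := exists_abs_sum_selbergLambda_sub_le
  refine ⟨C₁ + 16 * C₂ + 2 * (2 + C₃), by positivity, fun f hb z L hz hL => ?_⟩
  have hL0 : 0 < L := by linarith
  have hx1 : 1 ≤ Real.exp L := Real.one_le_exp hL0.le
  set I := ∫ v in (0 : ℝ)..L, |meanDiff f z (Real.exp v)| with hI
  have hI0 : 0 ≤ I := intervalIntegral.integral_nonneg hL0.le fun v _ => abs_nonneg _
  set G : ℝ → ℝ := (Set.Icc 0 L).indicator fun w => |meanDiff f z (Real.exp (L - w))| with hGdef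
  have hm : Measurable fun w => |meanDiff f z (Real.exp (L - w))| := by
    have := (measurable_meanDiff (f := f) (z := z)).comp
      (Real.measurable_exp.comp (measurable_const.sub measurable_id : Measurable fun w => L - w))
    simp only [Function.comp_def] at this
    fun_prop
  have hG : Integrable G := by
    rw [hGdef, integrable_indicator_iff measurableSet_Icc]
    refine Measure.integrableOn_of_bounded (M := 2) (by simp) hm.aestronglyMeasurable ?_
    exact Filter.Eventually.of_forall fun w => by simpa using abs_meanDiff_le hb z _
  have hGeq : ∀ w, 0 ≤ w → G w = |meanDiff f z (Real.exp (L - w))| := by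
    intro w hw
    rw [hGdef, Set.indicator_apply]
    split_ifs with h
    · rfl
    · have : L < w := by
        by_contra! h'
        exact h ⟨hw, h'⟩
      rw [meanDiff_of_lt_one hz (Real.exp_lt_one_iff.mpr (by linarith)), abs_zero]
  have hGI : ∫ w in Set.Icc 0 L, G w = I := by
    rw [integral_Icc_eq_integral_Ioc, ← intervalIntegral.integral_of_le hL0.le]
    have : ∫ w in (0 : ℝ)..L, G w = ∫ w in (0 : ℝ)..L, |meanDiff f z (Real.exp (L - w))| := by
      refine intervalIntegral.integral_congr fun w hw => hGeq w ?_
      rw [Set.uIcc_of_le hL0.le] at hw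
      exact hw.1
    rw [this, intervalIntegral.integral_comp_sub_left (fun v => |meanDiff f z (Real.exp v)|) L]
    simp [hI]
  have hmain := h₁ G L hL hG
    (fun w => Set.indicator_nonneg (fun _ _ => abs_nonneg _) w)
    (fun w hw => Set.indicator_of_notMem (by simp [hw]) _)
  rw [hGI] at hmain
  have hpt : ∀ n ∈ Finset.Icc 1 ⌊Real.exp L⌋₊,
      selbergLambda n / n * |meanDiff f z (Real.exp L / n)| ≤
        L * (selbergLambda n / n * ∫ w in Set.Ico (Real.log n) (Real.log n + 1 / L), G w) +
          (4 / L * (selbergLambda n / n) + (1 + z) / Real.exp L * selbergLambda n) := by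
    intro n hn
    obtain ⟨-, hn1, -, -⟩ := floor_pos_of_mem hn
    have hn0 : (0 : ℝ) < n := by linarith
    have ht : 0 < Real.exp L / n := by positivity
    have h4 : ∫ w in Set.Ico (Real.log n) (Real.log n + 1 / L),
        (|meanDiff f z (Real.exp L / n)| - (4 / L + (1 + z) / (Real.exp L / n))) ≤
        ∫ w in Set.Ico (Real.log n) (Real.log n + 1 / L), G w := by
      refine setIntegral_mono_on (integrableOn_const (by simp)) hG.integrableOn
        measurableSet_Ico fun w hw => ?_
      have hlog := Real.log_nonneg hn1
      rw [hGeq w (hlog.trans hw.1)]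
      have h5 := abs_meanDiff_le_add hb (by linarith) ht (v := w - Real.log n)
        (by linarith [hw.1]) (z := z)
      have h6 : Real.exp L / n * Real.exp (-(w - Real.log n)) = Real.exp (L - w) := by
        rw [neg_sub, Real.exp_sub, Real.exp_log hn0, Real.exp_sub]
        field_simp
      rw [h6] at h5
      have h7 : 4 * (w - Real.log n) ≤ 4 / L := by
        have : w - Real.log n ≤ 1 / L := by linarith [hw.2]
        calc _ ≤ 4 * (1 / L) := by gcongr
          _ = 4 / L := by ring
      linarith
    rw [setIntegral_const] at h4
    simp only [Measure.real, Real.volume_Ico, add_sub_cancel_left, smul_eq_mul] at h4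
    rw [ENNReal.toReal_ofReal (by positivity), one_div_mul_eq_div, div_le_iff₀ hL0] at h4
    have h8 : 0 ≤ selbergLambda n / n := div_nonneg (selbergLambda_nonneg n) hn0.le
    have h9 := mul_le_mul_of_nonneg_left h4 h8
    have h10 : selbergLambda n / n * ((1 + z) / (Real.exp L / n)) =
        (1 + z) / Real.exp L * selbergLambda n := by
      field_simp
    rw [← h10]
    linarith
  refine (Finset.sum_le_sum hpt).trans ?_
  rw [Finset.sum_add_distrib, Finset.sum_add_distrib, ← Finset.mul_sum, ← Finset.mul_sum,
    ← Finset.mul_sum]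
  have e1 := h₂ (Real.exp L) hx1
  have e2 := (abs_le.mp (h₃ (Real.exp L) hx1)).2
  rw [Real.log_exp] at e1 e2
  have e3 : (1 + L) ^ 2 ≤ 4 * L ^ 2 := by nlinarith
  have e4 : ∑ n ∈ Finset.Icc 1 ⌊Real.exp L⌋₊, selbergLambda n ≤ (2 + C₃) * L * Real.exp L := by
    have : C₃ * Real.exp L * 1 ≤ C₃ * Real.exp L * L := by gcongr
    linarith
  have hLz : L * 1 ≤ L * z := by gcongr
  calc _ ≤ L * (C₁ * I) + (4 / L * (C₂ * (4 * L ^ 2)) +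
        (1 + z) / Real.exp L * ((2 + C₃) * L * Real.exp L)) := by
        gcongr
        exact e1.trans (by gcongr)
    _ = C₁ * (L * I) + (16 * C₂ * L + (2 + C₃) * (L + L * z)) := by field_simp; ring
    _ ≤ C₁ * (L * I) + (16 * C₂ * (L * z) + (2 + C₃) * (L * z + L * z)) := by
        gcongr <;> linarith
    _ ≤ _ := by
        have : 0 ≤ C₁ * (L * z) := by positivity
        have : 0 ≤ (16 * C₂ + 2 * (2 + C₃)) * (L * I) := by positivity
        linarith

/-- The mean values of a completely multiplicative function with values in `[-1, 1]` vary
slowly. -/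
theorem exists_abs_meanDiff_le :
    ∃ C : ℝ, 0 < C ∧ ∀ f : ℕ → ℝ, IsComplMult f → (∀ n : ℕ, 0 < n → -1 ≤ f n ∧ f n ≤ 1) →
      ∀ z x : ℝ, 1 ≤ z → 0 < x → 1 ≤ Real.log x →
        |meanDiff f z x| ≤
          C * ((1 + Real.log z) * Real.log x ^ (-(7 / 24) : ℝ) + z / Real.log x) := by
  obtain ⟨C₁, hC₁, h₁⟩ := exists_integral_abs_meanDiff_le
  obtain ⟨C₂, hC₂, h₂⟩ := exists_sum_selbergLambda_mul_abs_meanDiff_le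
  have hl4 : 0 ≤ Real.log 4 := Real.log_nonneg (by norm_num)
  refine ⟨C₂ * C₁ + C₂ + 2 * (Real.log 4 + 6), by positivity, fun f hf hb z x hz hx hL => ?_⟩
  have hb' : ∀ n : ℕ, 0 < n → |f n| ≤ 1 := fun n hn => abs_le.mpr (hb n hn)
  have h3 := h₁ f hf hb z (Real.log x) hz hL
  have h4 := h₂ f hb' z (Real.log x) hz hL
  rw [Real.exp_log hx] at h4
  have h5 := abs_meanDiff_mul_log_sq_le hf hb' hz
    ((Real.log_nonneg_iff hx).mp (by linarith))
  have hℓ := Real.log_nonneg hz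
  set L := Real.log x
  have hL0 : 0 < L := by linarith
  set P := L ^ (17 / 24 : ℝ) with hP
  have hP1 : 1 ≤ P := Real.one_le_rpow hL (by norm_num)
  have hneg : L ^ (-(7 / 24) : ℝ) = P / L := by
    rw [hP, ← Real.rpow_sub_one hL0.ne']
    norm_num
  rw [hneg]
  have h6 : (2 + Real.log z) * (2 * L + (Real.log 4 + 4)) ≤
      2 * (Real.log 4 + 6) * ((1 + Real.log z) * (L * P)) := by
    have : 2 * L + (Real.log 4 + 4) ≤ (Real.log 4 + 6) * L := by nlinarith
    calc _ ≤ (2 * (1 + Real.log z)) * ((Real.log 4 + 6) * (L * P)) := by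
          gcongr
          · linarith
          · exact this.trans (by gcongr; exact le_mul_of_one_le_right hL0.le hP1)
      _ = _ := by ring
  have h7 : |meanDiff f z x| * L ^ 2 ≤
      (C₂ * C₁ + C₂ + 2 * (Real.log 4 + 6)) * ((1 + Real.log z) * (L * P) + L * z) := by
    have h8 : C₂ * (L * (∫ v in (0 : ℝ)..L, |meanDiff f z (Real.exp v)|) + L * z) ≤
        C₂ * (L * (C₁ * (1 + Real.log z) * P) + L * z) := by gcongr
    have p1 : 0 ≤ (C₂ * C₁ + 2 * (Real.log 4 + 6)) * (L * z) := by positivity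
    have p2 : 0 ≤ C₂ * ((1 + Real.log z) * (L * P)) := by positivity
    linarith
  rw [← le_div_iff₀ (by positivity)] at h7
  refine h7.trans (le_of_eq ?_)
  field_simp

end

section

open MeasureTheory Finset

theorem sum_sum_divisors (f : ℕ → ℝ) (x : ℝ) :
    ∑ n ∈ Icc 1 ⌊x⌋₊, ∑ d ∈ n.divisors, f d = ∑ d ∈ Icc 1 ⌊x⌋₊, f d * ⌊x / d⌋₊ := by
  have h := sum_Icc_sum_divisorsAntidiagonal x fun d _ => f d
  simp only [Nat.sum_divisorsAntidiagonal (fun d _ => f d)] at h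
  rw [h]
  refine sum_congr rfl fun d _ => ?_
  simp [mul_comm]

theorem sum_mul_floor_div {f : ℕ → ℝ} {x : ℝ} (hx : 0 < x) {K : ℕ} (hK : 0 < K) :
    ∑ d ∈ Ioc ⌊x / K⌋₊ ⌊x⌋₊, f d * ⌊x / d⌋₊ =
      ∑ m ∈ Icc 1 K, (partialSum f (x / m) - partialSum f (x / K)) := by
  have hK0 : (0 : ℝ) < K := by exact_mod_cast hK
  have h1 : ∀ d ∈ Ioc ⌊x / K⌋₊ ⌊x⌋₊, f d * ⌊x / d⌋₊ =
      ∑ m ∈ Icc 1 K, if (d * m : ℝ) ≤ x then f d else 0 := by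
    intro d hd
    obtain ⟨hd1, hd2⟩ := mem_Ioc.mp hd
    have hd0 : (0 : ℝ) < d := by exact_mod_cast (Nat.zero_le _).trans_lt hd1
    have hd3 : x / K < d := (Nat.floor_lt (by positivity)).mp hd1
    have hs : ({m ∈ Icc 1 K | (d * m : ℝ) ≤ x} : Finset ℕ) = Icc 1 ⌊x / d⌋₊ := by
      ext m
      simp only [mem_filter, mem_Icc, Nat.le_floor_iff (show 0 ≤ x / d by positivity),
        le_div_iff₀ hd0, mul_comm (d : ℝ)]
      constructor
      · rintro ⟨⟨h1, -⟩, h2⟩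
        exact ⟨h1, h2⟩
      · rintro ⟨h1, h2⟩
        refine ⟨⟨h1, ?_⟩, h2⟩
        rw [div_lt_iff₀ hK0] at hd3
        have : (m : ℝ) * d < K * d := by linarith
        exact_mod_cast (lt_of_mul_lt_mul_right this hd0.le).le
    rw [← sum_filter, hs]
    simp [mul_comm]
  rw [sum_congr rfl h1, sum_comm]
  refine sum_congr rfl fun m hm => ?_
  obtain ⟨hm1, hm2⟩ := mem_Icc.mp hm
  have hm0 : (0 : ℝ) < m := by exact_mod_cast hm1
  have hm3 : (m : ℝ) ≤ K := by exact_mod_cast hm2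
  rw [partialSum_sub_partialSum f (by gcongr), ← sum_filter]
  refine sum_congr ?_ fun _ _ => rfl
  ext d
  simp only [mem_filter, mem_Ioc]
  rw [← le_div_iff₀ hm0, ← Nat.le_floor_iff (by positivity)]
  have : ⌊x / m⌋₊ ≤ ⌊x⌋₊ :=
    Nat.floor_mono (div_le_self hx.le (by exact_mod_cast hm1))
  constructor
  · rintro ⟨⟨h1, -⟩, h2⟩
    exact ⟨h1, h2⟩
  · rintro ⟨h1, h2⟩
    exact ⟨⟨h1, h2.trans this⟩, h2⟩

theorem sum_Ioc_div_eq (f : ℕ → ℝ) {y x : ℝ} (hy : 0 < y) (hyx : y ≤ x) :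
    ∑ d ∈ Ioc ⌊y⌋₊ ⌊x⌋₊, f d / d =
      meanValue f x - meanValue f y + ∫ t in y..x, meanValue f t * t⁻¹ := by
  set c : ℕ → ℝ := fun n => if n = 0 then 0 else f n with hc
  have hS : ∀ t : ℝ, ∑ k ∈ Icc 0 ⌊t⌋₊, c k = partialSum f t := by
    intro t
    rw [partialSum, ← sum_subset (Icc_subset_Icc_left (zero_le_one' ℕ)) fun n hn hn' => ?_]
    · refine sum_congr rfl fun n hn => ?_
      have := (mem_Icc.mp hn).1
      simp only [hc]
      rw [if_neg (by omega)]
    · have : n = 0 := by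
        rw [mem_Icc] at hn hn'
        omega
      simp [hc, this]
  have hne : ∀ t ∈ Set.Icc y x, t ≠ 0 := fun t ht => (hy.trans_le ht.1).ne'
  have h := sum_mul_eq_sub_sub_integral_mul c (f := fun t : ℝ => t⁻¹) hy.le hyx
    (fun t ht => differentiableAt_inv (hne t ht)) ?_
  · simp only [hS] at h
    have h1 : ∑ d ∈ Ioc ⌊y⌋₊ ⌊x⌋₊, f d / d = ∑ k ∈ Ioc ⌊y⌋₊ ⌊x⌋₊, (k : ℝ)⁻¹ * c k := by
      refine sum_congr rfl fun n hn => ?_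
      have := (mem_Ioc.mp hn).1
      simp only [hc]
      rw [if_neg (by omega)]
      ring
    rw [h1, h, ← intervalIntegral.integral_of_le hyx]
    have h2 : ∫ t in y..x, meanValue f t * t⁻¹ =
        -∫ t in y..x, deriv (fun t : ℝ => t⁻¹) t * partialSum f t := by
      rw [← intervalIntegral.integral_neg]
      refine intervalIntegral.integral_congr fun t _ => ?_
      simp only [deriv_inv, meanValue]
      ring
    rw [h2, meanValue, meanValue]
    ring
  · refine ContinuousOn.integrableOn_Icc ?_
    simp only [deriv_inv']
    exact ((continuousOn_id.pow 2).inv₀ fun t ht => pow_ne_zero 2 (hne t ht)).neg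

theorem abs_integral_meanValue_sub_le {f : ℕ → ℝ} (hb : ∀ n : ℕ, 0 < n → |f n| ≤ 1)
    {x K M : ℝ} (hx : 0 < x) (hK : 1 ≤ K)
    (hM : ∀ z : ℝ, 1 ≤ z → z ≤ K → |meanDiff f z x| ≤ M) :
    |(∫ t in (x / K)..x, meanValue f t * t⁻¹) - meanValue f x * Real.log K| ≤
      M * Real.log K := by
  have hy0 : 0 < x / K := by positivity
  have hyx : x / K ≤ x := div_le_self hx.le hK
  have hlog : ∫ t in (x / K)..x, t⁻¹ = Real.log K := by
    rw [integral_inv_of_pos hy0 hx]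
    congr 1
    field_simp
  have hinv : IntervalIntegrable (fun t : ℝ => t⁻¹) volume (x / K) x :=
    intervalIntegral.intervalIntegrable_inv
      (fun t ht => by rw [Set.uIcc_of_le hyx] at ht; exact (hy0.trans_le ht.1).ne')
      continuousOn_id
  have hint : IntervalIntegrable (fun t => meanValue f t * t⁻¹) volume (x / K) x := by
    refine hinv.mono_fun (measurable_meanValue.mul measurable_inv).aestronglyMeasurable ?_
    refine Filter.Eventually.of_forall fun t => ?_
    simp only [norm_mul, Real.norm_eq_abs]
    exact mul_le_of_le_one_left (abs_nonneg _) (abs_meanValue_le hb t)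
  rw [← hlog, ← intervalIntegral.integral_const_mul, ← intervalIntegral.integral_const_mul,
    ← intervalIntegral.integral_sub hint (hinv.const_mul _), ← Real.norm_eq_abs]
  refine intervalIntegral.norm_integral_le_of_norm_le hyx ?_ (hinv.const_mul M)
  refine Filter.Eventually.of_forall fun t ht => ?_
  have ht0 : 0 < t := hy0.trans ht.1
  have h := hM (x / t) (by rw [le_div_iff₀ ht0]; linarith [ht.2])
    (by rw [div_le_comm₀ ht0 (by positivity)]; exact ht.1.le)
  rw [meanDiff, div_div_cancel₀ hx.ne'] at h
  rw [← sub_mul, Real.norm_eq_abs, abs_mul, abs_of_pos (inv_pos.mpr ht0), abs_sub_comm]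
  gcongr

theorem abs_sum_div_sub_le {f : ℕ → ℝ} (hb : ∀ n : ℕ, 0 < n → |f n| ≤ 1)
    {x M : ℝ} {K : ℕ} (hx : 0 < x) (hK : 0 < K)
    (hM : ∀ z : ℝ, 1 ≤ z → z ≤ K → |meanDiff f z x| ≤ M) :
    |∑ n ∈ Icc 1 ⌊x⌋₊, f n / n - (1 / x) * ∑ n ∈ Icc 1 ⌊x⌋₊, ∑ d ∈ n.divisors, f d -
        (1 - Real.eulerMascheroniConstant) * meanValue f x| ≤
      3 / K + M * (1 + 2 * Real.log K) := by
  have hK1 : (1 : ℝ) ≤ K := by exact_mod_cast hK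
  have hK0 : (0 : ℝ) < K := by linarith
  set y := x / K with hy
  have hy0 : 0 < y := by positivity
  have hyx : y ≤ x := div_le_self hx.le hK1
  have hsplit : ∀ h : ℕ → ℝ, ∑ d ∈ Icc 1 ⌊x⌋₊, h d =
      ∑ d ∈ Icc 1 ⌊y⌋₊, h d + ∑ d ∈ Ioc ⌊y⌋₊ ⌊x⌋₊, h d := by
    intro h
    rw [← partialSum_sub_partialSum h hyx, partialSum, partialSum]
    ring
  have hsmall : |∑ d ∈ Icc 1 ⌊y⌋₊, f d / d - 1 / x * ∑ d ∈ Icc 1 ⌊y⌋₊, f d * ⌊x / d⌋₊| ≤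
      1 / K := by
    rw [mul_sum, ← sum_sub_distrib]
    have : ∀ d ∈ Icc 1 ⌊y⌋₊, |f d / d - 1 / x * (f d * ⌊x / d⌋₊)| ≤ 1 / x := by
      intro d hd
      have hd1 := (mem_Icc.mp hd).1
      have hd0 : (0 : ℝ) < d := by exact_mod_cast hd1
      have h1 := Nat.floor_le (show 0 ≤ x / d by positivity)
      have h2 := Nat.lt_floor_add_one (x / d)
      have h3 : f d / d - 1 / x * (f d * ⌊x / d⌋₊) = f d * (1 / x * (x / d - ⌊x / d⌋₊)) := by
        field_simp
      have h4 : 0 ≤ x / d - ⌊x / d⌋₊ := by linarith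
      rw [h3, abs_mul, abs_of_nonneg (show 0 ≤ 1 / x * (x / d - ⌊x / d⌋₊) by positivity)]
      calc _ ≤ 1 * (1 / x * 1) := by
            gcongr
            · exact hb d hd1
            · linarith
        _ = 1 / x := by ring
    refine (abs_sum_le_sum_abs _ _).trans ((sum_le_sum this).trans ?_)
    rw [sum_const, Nat.card_Icc, nsmul_eq_mul, Nat.add_sub_cancel]
    calc (⌊y⌋₊ : ℝ) * (1 / x) ≤ y * (1 / x) := by gcongr; exact Nat.floor_le hy0.le
      _ = 1 / K := by rw [hy]; field_simp
  have hsum : 1 / x * ∑ m ∈ Icc 1 K, (partialSum f (x / m) - partialSum f y) =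
      ∑ m ∈ Icc 1 K, meanValue f (x / m) * (1 / m) - meanValue f y := by
    rw [sum_sub_distrib, mul_sub, mul_sum, sum_const, Nat.card_Icc, Nat.add_sub_cancel,
      nsmul_eq_mul]
    congr 1
    · refine sum_congr rfl fun m hm => ?_
      have hm0 : (0 : ℝ) < m := by exact_mod_cast (mem_Icc.mp hm).1
      rw [meanValue]
      field_simp
    · rw [meanValue, hy]
      field_simp
  have hH := abs_sum_one_div_sub_log_sub_le hK1
  rw [Nat.floor_natCast] at hH
  set H := ∑ m ∈ Icc 1 K, (1 : ℝ) / m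
  have hH1 : H ≤ 1 + Real.log K := by
    have h1 := harmonic_le_one_add_log K
    have h2 : ((harmonic K : ℚ) : ℝ) = H := by
      rw [harmonic_eq_sum_Icc]; push_cast; simp [H]
    linarith
  have hM0 : 0 ≤ M := (abs_nonneg _).trans (hM 1 le_rfl hK1)
  have hdisc : |∑ m ∈ Icc 1 K, meanValue f (x / m) * (1 / m) - meanValue f x * H| ≤
      M * H := by
    rw [mul_sum, mul_sum, ← sum_sub_distrib]
    refine (abs_sum_le_sum_abs _ _).trans (sum_le_sum fun m hm => ?_)
    obtain ⟨hm1, hm2⟩ := mem_Icc.mp hm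
    have h := hM m (by exact_mod_cast hm1) (by exact_mod_cast hm2)
    rw [meanDiff, abs_sub_comm] at h
    rw [← sub_mul, abs_mul, abs_of_nonneg (show (0 : ℝ) ≤ 1 / m by positivity)]
    gcongr
  have hint := abs_integral_meanValue_sub_le hb hx hK1 hM
  have hF : |meanValue f x * (H - Real.log K - Real.eulerMascheroniConstant)| ≤ 2 / K := by
    rw [abs_mul]
    exact (mul_le_of_le_one_left (abs_nonneg _) (abs_meanValue_le hb x)).trans hH
  rw [sum_sum_divisors, hsplit (fun d => f d / d), hsplit (fun d => f d * ⌊x / d⌋₊),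
    sum_Ioc_div_eq f hy0 hyx, sum_mul_floor_div hx hK, mul_add, hsum]
  have hMH : M * H ≤ M * (1 + Real.log K) := by gcongr
  have e : (3 : ℝ) / K = 1 / K + 2 / K := by ring
  rw [abs_le] at *
  rw [e]
  constructor <;> linarith

end

theorem exists_bound_of_log :
    ∃ C : ℝ, ∀ L : ℝ, 1 ≤ L → 3 / (⌈L ^ (1 / 5 : ℝ)⌉₊ : ℝ) +
      ((1 + Real.log ⌈L ^ (1 / 5 : ℝ)⌉₊) * L ^ (-(7 / 24) : ℝ) + ⌈L ^ (1 / 5 : ℝ)⌉₊ / L) *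
        (1 + 2 * Real.log ⌈L ^ (1 / 5 : ℝ)⌉₊) ≤ C / L ^ (1 / 5 : ℝ) := by
  refine ⟨3 + 81 * 43, fun L hL => ?_⟩
  have hL0 : 0 < L := by linarith
  set Y := L ^ (1 / 5 : ℝ) with hY
  have hY1 : 1 ≤ Y := Real.one_le_rpow hL (by norm_num)
  set K : ℝ := (⌈Y⌉₊ : ℝ) with hK
  have hKY : Y ≤ K := Nat.le_ceil Y
  have hK2 : K ≤ 2 * Y := by
    have := Nat.ceil_lt_add_one (zero_le_one.trans hY1)
    linarith
  have hK0 : 0 < K := by linarith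
  set V := L ^ (1 / 100 : ℝ) with hV
  have hV1 : 1 ≤ V := Real.one_le_rpow hL (by norm_num)
  have hlog : Real.log K ≤ 40 * V := by
    have h1 := Real.log_le_rpow_div hK0.le (show (0 : ℝ) < 1 / 20 by norm_num)
    have h2 : K ^ (1 / 20 : ℝ) ≤ 2 * V := by
      calc K ^ (1 / 20 : ℝ) ≤ (2 * Y) ^ (1 / 20 : ℝ) := by gcongr
        _ = 2 ^ (1 / 20 : ℝ) * V := by
          rw [Real.mul_rpow (by norm_num) (by linarith), hY, hV, ← Real.rpow_mul hL0.le]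
          norm_num
        _ ≤ 2 ^ (1 : ℝ) * V := by
          gcongr <;> norm_num
        _ = 2 * V := by rw [Real.rpow_one]
    linarith
  have hlog0 : 0 ≤ Real.log K := Real.log_nonneg (hY1.trans hKY)
  have hinv : 1 / Y = L ^ (-(1 / 5) : ℝ) := by rw [Real.rpow_neg hL0.le, one_div]
  have h1 : V * V * L ^ (-(7 / 24) : ℝ) ≤ 1 / Y := by
    rw [hinv, hV, ← Real.rpow_add hL0, ← Real.rpow_add hL0]
    exact Real.rpow_le_rpow_of_exponent_le hL (by norm_num)
  have h2 : Y / L * V ≤ 1 / Y := by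
    rw [hinv, hV, hY, ← Real.rpow_sub_one hL0.ne', ← Real.rpow_add hL0]
    exact Real.rpow_le_rpow_of_exponent_le hL (by norm_num)
  calc 3 / K + ((1 + Real.log K) * L ^ (-(7 / 24) : ℝ) + K / L) * (1 + 2 * Real.log K)
      ≤ 3 / Y + (41 * V * L ^ (-(7 / 24) : ℝ) + 2 * Y / L) * (81 * V) := by
        gcongr <;> linarith
    _ = 3 / Y + 81 * (41 * (V * V * L ^ (-(7 / 24) : ℝ)) + 2 * (Y / L * V)) := by ring
    _ ≤ 3 / Y + 81 * (41 * (1 / Y) + 2 * (1 / Y)) := by gcongr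
    _ = _ := by ring

/-- Proposition 3.1: for `x ≥ x₀` and completely multiplicative `f` with
`-1 ≤ f n ≤ 1`, with `g n = ∑_{d ∣ n} f d`,
`∑_{n ≤ x} f n / n = (1/x) ∑_{n ≤ x} g n + (1-γ) (1/x) ∑_{n ≤ x} f n + O(1/(log x)^{1/5})`. -/
theorem prop_3_1 :
    ∃ C x₀ : ℝ, ∀ x : ℝ, x₀ ≤ x →
      ∀ f : ℕ → ℝ, IsComplMult f → (∀ n : ℕ, 0 < n → -1 ≤ f n ∧ f n ≤ 1) →
        |∑ n ∈ Finset.Icc 1 ⌊x⌋₊, f n / n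
            - (1 / x) * ∑ n ∈ Finset.Icc 1 ⌊x⌋₊, (∑ d ∈ n.divisors, f d)
            - (1 - Real.eulerMascheroniConstant) * ((1 / x) * ∑ n ∈ Finset.Icc 1 ⌊x⌋₊, f n)|
          ≤ C / (Real.log x) ^ ((1 : ℝ) / 5) := by
  obtain ⟨C₁, hC₁, h₁⟩ := exists_abs_meanDiff_le
  obtain ⟨C₂, h₂⟩ := exists_bound_of_log
  refine ⟨(1 + C₁) * C₂, Real.exp 1, fun x hx f hf hb => ?_⟩
  have hb' : ∀ n : ℕ, 0 < n → |f n| ≤ 1 := fun n hn => abs_le.mpr (hb n hn)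
  have hx0 : 0 < x := (Real.exp_pos 1).trans_le hx
  have hL : 1 ≤ Real.log x := (Real.le_log_iff_exp_le hx0).mpr hx
  have h₂ := h₂ (Real.log x) hL
  set L := Real.log x
  have hL0 : 0 < L := by linarith
  set K := ⌈L ^ (1 / 5 : ℝ)⌉₊
  have hK : 0 < K := Nat.ceil_pos.mpr (by positivity)
  have hlog : 0 ≤ Real.log K := Real.log_natCast_nonneg K
  have h := abs_sum_div_sub_le hb' hx0 hK
    (M := C₁ * ((1 + Real.log K) * L ^ (-(7 / 24) : ℝ) + K / L)) fun z hz hzK => by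
      refine (h₁ f hf hb z x hz hx0 hL).trans ?_
      gcongr
  have hmean : (1 / x) * ∑ n ∈ Finset.Icc 1 ⌊x⌋₊, f n = meanValue f x := by
    rw [meanValue, partialSum, one_div_mul_eq_div]
  rw [hmean]
  refine h.trans ?_
  have hp1 : 0 ≤ 3 / (K : ℝ) := by positivity
  have hp2 : 0 ≤ ((1 + Real.log K) * L ^ (-(7 / 24) : ℝ) + K / L) * (1 + 2 * Real.log K) := by
    positivity
  rw [mul_div_assoc]
  refine le_trans ?_ (mul_le_mul_of_nonneg_left h₂ (by linarith))
  nlinarith [mul_nonneg hC₁.le hp1]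
end
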